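/- arXiv:2509.04099 — 6 statements merged into one kernel-verified Lean document; each statement's English description precedes it below -/
import Mathlib

section
/- For any a, b > 0 there exists ρ = ρ(a,b) > 0 and a positive solution (u,v) ∈ C²([0,ρ))² of the radial system u'' + ((n−1)/r) u' = p(r) g(v), v'' + ((n−1)/r) v' = q(r) f(u) with u(0)=a, v(0)=b, u'(0)=v'(0)=0; moreover u'(r) ≥ 0 and v'(r) ≥ 0 for all r ∈ (0,ρ). -/
open MeasureTheory Set Filter Topology

noncomputable section

/-- The iterated radial kernel
`∫₀^r t^{1-n} ∫₀^t s^{n-1} w(s) h(φ(s)) ds dt`. -/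
def radK (n : ℕ) (w h φ : ℝ → ℝ) (r : ℝ) : ℝ :=
  ∫ t in (0:ℝ)..r, t ^ (1 - (n : ℤ)) *
    ∫ s in (0:ℝ)..t, s ^ ((n : ℤ) - 1) * w s * h (φ s)

/-- Hypothesis (F1). -/
def hypF1 (f g : ℝ → ℝ) : Prop :=
  ContinuousOn f (Ici 0) ∧ ContinuousOn g (Ici 0) ∧
  DifferentiableOn ℝ f (Ioi 0) ∧ DifferentiableOn ℝ g (Ioi 0) ∧
  MonotoneOn f (Ici 0) ∧ MonotoneOn g (Ici 0) ∧
  f 0 = 0 ∧ g 0 = 0 ∧ (∀ s : ℝ, 0 < s → 0 < f s) ∧ (∀ s : ℝ, 0 < s → 0 < g s)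

/-- Hypothesis (F2): multiplicative subadditivity. -/
def hypF2 (f g : ℝ → ℝ) : Prop :=
  (∀ s : ℝ, 0 ≤ s → ∀ r : ℝ, 0 ≤ r → f (s * r) ≤ f s * f r) ∧
  (∀ l : ℝ, 0 ≤ l → ∀ t : ℝ, 0 ≤ t → g (l * t) ≤ g l * g t)

/-- Hypothesis (F3): finite Keller–Osserman integrals. -/
def hypF3 (f g : ℝ → ℝ) : Prop :=
  IntegrableOn (fun t : ℝ => 1 / Real.sqrt (∫ z in (0:ℝ)..t, g (f z))) (Ioi 1) ∧
  IntegrableOn (fun t : ℝ => 1 / Real.sqrt (∫ z in (0:ℝ)..t, f (g z))) (Ioi 1)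

/-- Hypothesis (PQ). -/
def hypPQ (p q : ℝ → ℝ) : Prop :=
  ContinuousOn p (Ici 0) ∧ ContinuousOn q (Ici 0) ∧
  (∀ s : ℝ, 0 ≤ s → 0 ≤ p s) ∧ (∀ s : ℝ, 0 ≤ s → 0 ≤ q s) ∧
  (¬ ∀ s : ℝ, 0 ≤ s → p s = 0 ∧ q s = 0) ∧
  IntegrableOn (fun s : ℝ => s * p s) (Ioi 0) ∧
  IntegrableOn (fun s : ℝ => s * q s) (Ioi 0) ∧
  ¬ ∃ R : ℝ, ∀ s : ℝ, R ≤ s → min (p s) (q s) = 0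

/-- `L_w = (1/(n-2)) ∫₀^∞ s w(s) ds`. -/
def Lcoef (n : ℕ) (w : ℝ → ℝ) : ℝ := (1 / ((n : ℝ) - 2)) * ∫ s in Ioi (0:ℝ), s * w s

/-- Keller–Osserman transform `Φ(t) = ∫_t^∞ ds / g(f(s))`. -/
def PhiKO (f g : ℝ → ℝ) (t : ℝ) : ℝ := ∫ s in Ioi t, 1 / g (f s)

/-- Keller–Osserman transform `Ψ(t) = ∫_t^∞ ds / f(g(s))`. -/
def PsiKO (f g : ℝ → ℝ) (t : ℝ) : ℝ := ∫ s in Ioi t, 1 / f (g s)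

/-- Positive radial `C²` solution (integral form) on `[0, ρ)` with central values `(a,b)`. -/
def IsRadSol (n : ℕ) (p q f g : ℝ → ℝ) (a b ρ : ℝ) (u v : ℝ → ℝ) : Prop :=
  ContDiffOn ℝ 2 u (Ico 0 ρ) ∧ ContDiffOn ℝ 2 v (Ico 0 ρ) ∧
  (∀ r ∈ Ico (0:ℝ) ρ, 0 < u r ∧ 0 < v r) ∧
  (∀ r ∈ Ico (0:ℝ) ρ, u r = a + radK n p g v r) ∧
  (∀ r ∈ Ico (0:ℝ) ρ, v r = b + radK n q f u r)

/-- Positive radial `C²` solution (integral form) on the closed interval `[0, R]`. -/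
def IsRadSolIcc (n : ℕ) (p q f g : ℝ → ℝ) (a b R : ℝ) (u v : ℝ → ℝ) : Prop :=
  ContDiffOn ℝ 2 u (Icc 0 R) ∧ ContDiffOn ℝ 2 v (Icc 0 R) ∧
  (∀ r ∈ Icc (0:ℝ) R, 0 < u r ∧ 0 < v r) ∧
  (∀ r ∈ Icc (0:ℝ) R, u r = a + radK n p g v r) ∧
  (∀ r ∈ Icc (0:ℝ) R, v r = b + radK n q f u r)

/-- Entire positive radial `C²` solution (integral form) with central values `(a,b)`. -/
def IsEntireRadSol (n : ℕ) (p q f g : ℝ → ℝ) (a b : ℝ) (u v : ℝ → ℝ) : Prop :=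
  ContDiffOn ℝ 2 u (Ici 0) ∧ ContDiffOn ℝ 2 v (Ici 0) ∧
  (∀ r ∈ Ici (0:ℝ), 0 < u r ∧ 0 < v r) ∧
  (∀ r ∈ Ici (0:ℝ), u r = a + radK n p g v r) ∧
  (∀ r ∈ Ici (0:ℝ), v r = b + radK n q f u r)

/-- Positive `C²` solution of the radial ODE system on `[0, ρ)` with central values `(a,b)`. -/
def IsRadODESol (n : ℕ) (p q f g : ℝ → ℝ) (a b ρ : ℝ) (u v : ℝ → ℝ) : Prop :=
  ContDiffOn ℝ 2 u (Ico 0 ρ) ∧ ContDiffOn ℝ 2 v (Ico 0 ρ) ∧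
  (∀ r ∈ Ico (0:ℝ) ρ, 0 < u r ∧ 0 < v r) ∧
  u 0 = a ∧ v 0 = b ∧ deriv u 0 = 0 ∧ deriv v 0 = 0 ∧
  (∀ r ∈ Ioo (0:ℝ) ρ,
    deriv (deriv u) r + ((n : ℝ) - 1) / r * deriv u r = p r * g (v r) ∧
    deriv (deriv v) r + ((n : ℝ) - 1) / r * deriv v r = q r * f (u r))

/-- The set `S` of central values admitting an entire positive radial solution. -/
def centralSet (n : ℕ) (p q f g : ℝ → ℝ) : Set (ℝ × ℝ) :=
  {ab : ℝ × ℝ | 0 ≤ ab.1 ∧ 0 ≤ ab.2 ∧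
    ∃ u v : ℝ → ℝ, IsEntireRadSol n p q f g ab.1 ab.2 u v}

/-- The set of radii `ρ > 0` on which a positive solution of the radial ODE system exists. -/
def odeSolSet (n : ℕ) (p q f g : ℝ → ℝ) (a b : ℝ) : Set ℝ :=
  {ρ : ℝ | 0 < ρ ∧ ∃ u v : ℝ → ℝ, IsRadODESol n p q f g a b ρ u v}

end

noncomputable def MM (m : ℕ) (h : ℝ → ℝ) (s : ℝ) : ℝ := ∫ t in (0:ℝ)..1, t ^ m * h (s * t)

noncomputable def TT (m : ℕ) (h : ℝ → ℝ) (r : ℝ) : ℝ := ∫ s in (0:ℝ)..r, s * MM m h s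

lemma MM_cont (m : ℕ) {h : ℝ → ℝ} (hh : Continuous h) : Continuous (MM m h) := by
  unfold MM
  apply intervalIntegral.continuous_parametric_intervalIntegral_of_continuous'
  simp only [Function.uncurry_def]
  fun_prop

lemma TT_deriv (m : ℕ) {h : ℝ → ℝ} (hh : Continuous h) (r : ℝ) :
    HasDerivAt (TT m h) (r * MM m h r) r := by
  have hc : Continuous (fun s => s * MM m h s) := continuous_id.mul (MM_cont m hh)
  exact intervalIntegral.integral_hasDerivAt_right (hc.intervalIntegrable _ _)
    (hc.stronglyMeasurableAtFilter _ _) hc.continuousAt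

lemma MM_eq (m : ℕ) (h : ℝ → ℝ) (r : ℝ) :
    r ^ (m+1) * MM m h r = ∫ s in (0:ℝ)..r, s ^ m * h s := by
  have := intervalIntegral.mul_integral_comp_mul_left (a := 0) (b := 1)
    (f := fun s => s ^ m * h s) (c := r)
  simp only [mul_zero, mul_one] at this
  rw [← this, pow_succ', mul_assoc, MM, ← intervalIntegral.integral_const_mul]
  congr 1
  apply intervalIntegral.integral_congr
  intro t _
  simp only [mul_pow]
  ring

lemma MM_zero (m : ℕ) (h : ℝ → ℝ) : MM m h 0 = h 0 / (m + 1) := by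
  simp only [MM, zero_mul, intervalIntegral.integral_mul_const, integral_pow]
  simp
  ring

lemma W_deriv (m : ℕ) {h : ℝ → ℝ} (hh : Continuous h) (r : ℝ) :
    HasDerivAt (fun r => r * MM m h r) (h r - m * MM m h r) r := by
  by_cases hr : r = 0
  · subst hr
    have e : h 0 - m * MM m h 0 = MM m h 0 := by
      rw [MM_zero]
      have : (m:ℝ) + 1 ≠ 0 := by positivity
      field_simp
      ring
    rw [e, hasDerivAt_iff_tendsto_slope]
    have h1 : Tendsto (MM m h) (𝓝[≠] 0) (𝓝 (MM m h 0)) :=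
      ((MM_cont m hh).tendsto 0).mono_left nhdsWithin_le_nhds
    refine h1.congr' ?_
    filter_upwards [self_mem_nhdsWithin] with y hy
    have : y ≠ 0 := hy
    simp [slope_def_field]
    field_simp
  · have hc : Continuous (fun s => s ^ m * h s) := by fun_prop
    have hI : HasDerivAt (fun r => ∫ s in (0:ℝ)..r, s ^ m * h s) (r ^ m * h r) r :=
      intervalIntegral.integral_hasDerivAt_right (hc.intervalIntegrable _ _)
        (hc.stronglyMeasurableAtFilter _ _) hc.continuousAt
    have hd := hI.div (hasDerivAt_pow m r) (pow_ne_zero m hr)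
    rw [← MM_eq] at hd
    refine (hd.congr_deriv ?_).congr_of_eventuallyEq ?_
    · rcases m with _ | k
      · simp
      · simp only [Nat.add_sub_cancel]
        field_simp
        ring
    · filter_upwards [isOpen_ne.mem_nhds hr] with y hy
      have : y ≠ 0 := hy
      simp only [Pi.div_apply]
      rw [← MM_eq]
      field_simp
      ring

lemma MM_mono (m : ℕ) {h k : ℝ → ℝ} (hh : Continuous h) (hk : Continuous k)
    (hle : ∀ x, h x ≤ k x) (s : ℝ) : MM m h s ≤ MM m k s := by
  unfold MM
  apply intervalIntegral.integral_mono_on zero_le_one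
  · exact Continuous.intervalIntegrable (by fun_prop) _ _
  · exact Continuous.intervalIntegrable (by fun_prop) _ _
  · intro t ht
    exact mul_le_mul_of_nonneg_left (hle _) (pow_nonneg ht.1 _)

lemma MM_nonneg (m : ℕ) {h : ℝ → ℝ} (hle : ∀ x, 0 ≤ h x) (s : ℝ) : 0 ≤ MM m h s := by
  unfold MM
  apply intervalIntegral.integral_nonneg zero_le_one
  intro t ht
  exact mul_nonneg (pow_nonneg ht.1 _) (hle _)

lemma MM_abs (m : ℕ) {h : ℝ → ℝ} {K : ℝ} (hle : ∀ x, |h x| ≤ K) (s : ℝ) : |MM m h s| ≤ K := by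
  have := intervalIntegral.norm_integral_le_of_norm_le_const (a := (0:ℝ)) (b := 1)
    (f := fun t => t ^ m * h (s * t)) (C := K) ?_
  · simpa [MM] using this
  · intro t ht
    rw [uIoc_of_le zero_le_one] at ht
    rw [Real.norm_eq_abs, abs_mul, abs_of_nonneg (pow_nonneg ht.1.le _)]
    calc t ^ m * |h (s*t)| ≤ 1 * |h (s*t)| := by
          gcongr
          exact pow_le_one₀ ht.1.le ht.2
      _ ≤ K := by simpa using hle _

lemma TT_eq (m : ℕ) (h : ℝ → ℝ) (r : ℝ) :
    TT m h r = r ^ 2 * ∫ t in (0:ℝ)..1, t * MM m h (r * t) := by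
  have := intervalIntegral.mul_integral_comp_mul_left (a := 0) (b := 1)
    (f := fun s => s * MM m h s) (c := r)
  simp only [mul_zero, mul_one] at this
  rw [TT, ← this, pow_two, mul_assoc]
  simp only [mul_assoc, intervalIntegral.integral_const_mul]

lemma TT_mono (m : ℕ) {h k : ℝ → ℝ} (hh : Continuous h) (hk : Continuous k)
    (hle : ∀ x, h x ≤ k x) (r : ℝ) : TT m h r ≤ TT m k r := by
  rw [TT_eq, TT_eq]
  have c1 := MM_cont m hh
  have c2 := MM_cont m hk
  refine mul_le_mul_of_nonneg_left ?_ (sq_nonneg r)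
  apply intervalIntegral.integral_mono_on zero_le_one
  · exact Continuous.intervalIntegrable (by fun_prop) _ _
  · exact Continuous.intervalIntegrable (by fun_prop) _ _
  · intro t ht
    exact mul_le_mul_of_nonneg_left (MM_mono m hh hk hle _) ht.1

lemma TT_nonneg (m : ℕ) {h : ℝ → ℝ} (hle : ∀ x, 0 ≤ h x) (r : ℝ) : 0 ≤ TT m h r := by
  rw [TT_eq]
  refine mul_nonneg (sq_nonneg r) (intervalIntegral.integral_nonneg zero_le_one ?_)
  intro t ht
  exact mul_nonneg ht.1 (MM_nonneg m hle _)

lemma TT_lip (m : ℕ) {h : ℝ → ℝ} (hh : Continuous h) {K : ℝ} (hle : ∀ x, |h x| ≤ K) {R x y : ℝ}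
    (hx : |x| ≤ R) (hy : |y| ≤ R) : |TT m h y - TT m h x| ≤ R * K * |y - x| := by
  have hR : 0 ≤ R := (abs_nonneg x).trans hx
  have := (convex_Icc (-R) R).norm_image_sub_le_of_norm_hasDerivWithin_le (f := TT m h)
    (f' := fun r => r * MM m h r) (C := R * K) (x := x) (y := y)
    (fun r _ => (TT_deriv m hh r).hasDerivWithinAt) ?_ (abs_le.1 hx) (abs_le.1 hy)
  · simpa using this
  · intro r hr
    rw [Real.norm_eq_abs, abs_mul]
    exact mul_le_mul (abs_le.2 hr) (MM_abs m hle r) (abs_nonneg _) hR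

lemma MM_lim (m : ℕ) {h : ℕ → ℝ → ℝ} {k : ℝ → ℝ} (hh : ∀ i, Continuous (h i))
    {K : ℝ} (hle : ∀ i x, |h i x| ≤ K) (hl : ∀ x, Tendsto (fun i => h i x) atTop (𝓝 (k x)))
    (s : ℝ) : Tendsto (fun i => MM m (h i) s) atTop (𝓝 (MM m k s)) := by
  unfold MM
  apply intervalIntegral.tendsto_integral_filter_of_dominated_convergence (fun _ => K)
  · refine Eventually.of_forall fun i => ?_
    have := hh i
    exact Continuous.aestronglyMeasurable (by fun_prop)
  · refine Eventually.of_forall fun i => Eventually.of_forall fun t ht => ?_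
    rw [uIoc_of_le zero_le_one] at ht
    rw [Real.norm_eq_abs, abs_mul, abs_of_nonneg (pow_nonneg ht.1.le _)]
    calc t ^ m * |h i (s*t)| ≤ 1 * |h i (s*t)| := by
          gcongr
          exact pow_le_one₀ ht.1.le ht.2
      _ ≤ K := by simpa using hle _ _
  · simp
  · exact Eventually.of_forall fun t _ => (hl _).const_mul _

lemma TT_lim (m : ℕ) {h : ℕ → ℝ → ℝ} {k : ℝ → ℝ} (hh : ∀ i, Continuous (h i))
    {K : ℝ} (hle : ∀ i x, |h i x| ≤ K) (hl : ∀ x, Tendsto (fun i => h i x) atTop (𝓝 (k x)))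
    (r : ℝ) : Tendsto (fun i => TT m (h i) r) atTop (𝓝 (TT m k r)) := by
  unfold TT
  apply intervalIntegral.tendsto_integral_filter_of_dominated_convergence (fun s => |s| * K)
  · refine Eventually.of_forall fun i => ?_
    have := MM_cont m (hh i)
    exact Continuous.aestronglyMeasurable (by fun_prop)
  · refine Eventually.of_forall fun i => Eventually.of_forall fun t ht => ?_
    rw [Real.norm_eq_abs, abs_mul]
    exact mul_le_mul_of_nonneg_left (MM_abs m (hle i) t) (abs_nonneg _)
  · exact Continuous.intervalIntegrable (by fun_prop) _ _
  · exact Eventually.of_forall fun t _ => (MM_lim m hh hle hl t).const_mul _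

/-- the coefficient data -/
structure Nice (P G : ℝ → ℝ) (K : ℝ) : Prop where
  cP : Continuous P
  cG : Continuous G
  P0 : ∀ x, 0 ≤ P x
  G0 : ∀ x, 0 ≤ G x
  mG : Monotone G
  bd : ∀ x y, P x * G y ≤ K

lemma Nice.abs_le {P G : ℝ → ℝ} {K : ℝ} (H : Nice P G K) (x y : ℝ) : |P x * G y| ≤ K := by
  rw [abs_of_nonneg (mul_nonneg (H.P0 x) (H.G0 y))]
  exact H.bd x y

lemma Nice.cont {P G : ℝ → ℝ} {K : ℝ} (H : Nice P G K) {φ : ℝ → ℝ} (hφ : Continuous φ) :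
    Continuous (fun s => P s * G (φ s)) := H.cP.mul (H.cG.comp hφ)

noncomputable def SS (m : ℕ) (c : ℝ) (P G φ : ℝ → ℝ) (r : ℝ) : ℝ :=
  c + TT m (fun s => P s * G (φ s)) r

lemma SS_cont (m : ℕ) (c : ℝ) {P G : ℝ → ℝ} {K : ℝ} (H : Nice P G K) {φ : ℝ → ℝ}
    (hφ : Continuous φ) : Continuous (SS m c P G φ) :=
  continuous_const.add
    (continuous_iff_continuousAt.2 fun r => (TT_deriv m (H.cont hφ) r).continuousAt)

lemma SS_mono (m : ℕ) (c : ℝ) {P G : ℝ → ℝ} {K : ℝ} (H : Nice P G K) {φ ψ : ℝ → ℝ}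
    (hφ : Continuous φ) (hψ : Continuous ψ) (hle : φ ≤ ψ) : SS m c P G φ ≤ SS m c P G ψ := by
  intro r
  have := TT_mono m (H.cont hφ) (H.cont hψ)
    (fun x => mul_le_mul_of_nonneg_left (H.mG (hle x)) (H.P0 x)) r
  simpa [SS] using this

lemma SS_ge (m : ℕ) (c : ℝ) {P G : ℝ → ℝ} {K : ℝ} (H : Nice P G K) (φ : ℝ → ℝ) (r : ℝ) :
    c ≤ SS m c P G φ r := by
  have := TT_nonneg m (h := fun s => P s * G (φ s)) (fun x => mul_nonneg (H.P0 x) (H.G0 _)) r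
  simpa [SS] using this

lemma SS_zero (m : ℕ) (c : ℝ) (P G φ : ℝ → ℝ) : SS m c P G φ 0 = c := by
  simp [SS, TT]

lemma SS_lip (m : ℕ) (c : ℝ) {P G : ℝ → ℝ} {K : ℝ} (H : Nice P G K) {φ : ℝ → ℝ}
    (hφ : Continuous φ) {R x y : ℝ} (hx : |x| ≤ R) (hy : |y| ≤ R) :
    |SS m c P G φ y - SS m c P G φ x| ≤ R * K * |y - x| := by
  have := TT_lip m (H.cont hφ) (fun x => H.abs_le x _) hx hy
  simpa [SS] using this

lemma SS_lim (m : ℕ) (c : ℝ) {P G : ℝ → ℝ} {K : ℝ} (H : Nice P G K) {φ : ℕ → ℝ → ℝ}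
    {ψ : ℝ → ℝ} (hφ : ∀ i, Continuous (φ i))
    (hl : ∀ x, Tendsto (fun i => φ i x) atTop (𝓝 (ψ x))) (r : ℝ) :
    Tendsto (fun i => SS m c P G (φ i) r) atTop (𝓝 (SS m c P G ψ r)) := by
  refine tendsto_const_nhds.add (TT_lim m (fun i => H.cont (hφ i)) (fun i x => H.abs_le x _) ?_ r)
  intro x
  exact ((H.cG.tendsto _).comp (hl x)).const_mul _

lemma fixed (m : ℕ) (a b : ℝ) {P Q F G : ℝ → ℝ} {K L : ℝ} (H : Nice P G K) (J : Nice Q F L) :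
    ∃ u : ℝ → ℝ, Continuous u ∧ u = SS m a P G (SS m b Q F u) := by
  let S : (ℝ → ℝ) → (ℝ → ℝ) := fun φ => SS m a P G (SS m b Q F φ)
  let U : ℕ → ℝ → ℝ := fun k => S^[k] (fun _ => a)
  have hs : ∀ k, U (k+1) = S (U k) := fun k => Function.iterate_succ_apply' S k _
  have hS : ∀ φ, Continuous φ → Continuous (S φ) := fun φ h => SS_cont m a H (SS_cont m b J h)
  have hc : ∀ k, Continuous (U k) := by
    intro k
    induction k with
    | zero => exact continuous_const
    | succ k ih => rw [hs]; exact hS _ ih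
  have hm : ∀ k, U k ≤ U (k+1) := by
    intro k
    induction k with
    | zero =>
      rw [hs]
      intro r
      exact SS_ge m a H _ r
    | succ k ih =>
      rw [hs (k+1), hs k]
      rw [hs k] at ih
      exact SS_mono m a H (SS_cont m b J (hc _)) (SS_cont m b J (hS _ (hc k)))
        (SS_mono m b J (hc _) (hS _ (hc k)) ih)
  have hmono : Monotone U := monotone_nat_of_le_succ hm
  have hb : ∀ k r, U k r ≤ a + |r| * K * |r| := by
    intro k r
    refine (hm k r).trans ?_
    rw [hs]
    have := SS_lip m a H (SS_cont m b J (hc k)) (R := |r|) (x := 0) (y := r) (by simp) le_rfl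
    rw [SS_zero] at this
    have h2 := (le_abs_self _).trans this
    simp only [sub_zero] at h2
    change SS m a P G (SS m b Q F (U k)) r ≤ _
    linarith
  have hlim : ∀ r, Tendsto (fun k => U k r) atTop (𝓝 (⨆ k, U k r)) := fun r =>
    tendsto_atTop_ciSup (fun i j h => hmono h r) ⟨_, by rintro _ ⟨k, rfl⟩; exact hb k r⟩
  set u : ℝ → ℝ := fun r => ⨆ k, U k r with hu
  have hul : ∀ R x y, |x| ≤ R → |y| ≤ R → |u y - u x| ≤ R * K * |y - x| := by
    intro R x y hx hy
    have ht := ((((hlim y).sub (hlim x)).abs).comp (tendsto_add_atTop_nat 1))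
    refine le_of_tendsto ht (Eventually.of_forall fun k => ?_)
    simp only [Function.comp]
    rw [hs]
    exact SS_lip m a H (SS_cont m b J (hc k)) hx hy
  have huc : Continuous u := by
    rw [continuous_iff_continuousAt]
    intro x
    have h1 : Tendsto (fun y => (|x|+1) * K * |y - x|) (𝓝 x) (𝓝 0) := by
      have : Continuous (fun y => (|x|+1) * K * |y - x|) := by fun_prop
      simpa using this.tendsto x
    have : Tendsto (fun y => u y - u x) (𝓝 x) (𝓝 0) := by
      refine squeeze_zero_norm' ?_ h1
      have : ∀ᶠ y in 𝓝 x, |y| < |x| + 1 :=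
        continuous_abs.continuousAt.eventually_lt continuousAt_const (by linarith)
      filter_upwards [this] with y hy
      exact hul _ _ _ (by linarith) hy.le
    exact tendsto_sub_nhds_zero_iff.1 this
  refine ⟨u, huc, ?_⟩
  funext r
  have h1 : Tendsto (fun k => U (k+1) r) atTop (𝓝 (SS m a P G (SS m b Q F u) r)) := by
    simp only [hs]
    exact SS_lim m a H (fun k => SS_cont m b J (hc k)) (fun x => SS_lim m b J hc hlim x) r
  exact tendsto_nhds_unique ((hlim r).comp (tendsto_add_atTop_nat 1)) h1

lemma SS_props (m : ℕ) (c : ℝ) {P G : ℝ → ℝ} {K : ℝ} (H : Nice P G K) {φ : ℝ → ℝ}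
    (hφ : Continuous φ) : ContDiff ℝ 2 (SS m c P G φ) ∧ deriv (SS m c P G φ) 0 = 0 ∧
    ∀ r, 0 < r → 0 ≤ deriv (SS m c P G φ) r ∧
      deriv (deriv (SS m c P G φ)) r + (m:ℝ) / r * deriv (SS m c P G φ) r = P r * G (φ r) := by
  set h := fun s => P s * G (φ s) with hh
  have hc : Continuous h := H.cont hφ
  have d1 : ∀ r, HasDerivAt (SS m c P G φ) (r * MM m h r) r := fun r =>
    (TT_deriv m hc r).const_add c
  have e1 : deriv (SS m c P G φ) = fun r => r * MM m h r := funext fun r => (d1 r).deriv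
  have e2 : deriv (fun r => r * MM m h r) = fun r => h r - m * MM m h r :=
    funext fun r => (W_deriv m hc r).deriv
  refine ⟨?_, ?_, ?_⟩
  · rw [show (2 : WithTop ℕ∞) = 1 + 1 by norm_num, contDiff_succ_iff_deriv]
    refine ⟨fun r => (d1 r).differentiableAt, by simp, ?_⟩
    rw [e1, contDiff_one_iff_deriv, e2]
    exact ⟨fun r => (W_deriv m hc r).differentiableAt,
      hc.sub (continuous_const.mul (MM_cont m hc))⟩
  · simp [e1]
  · intro r hr
    rw [e1, e2]
    refine ⟨mul_nonneg hr.le (MM_nonneg m (fun x => mul_nonneg (H.P0 x) (H.G0 _)) r), ?_⟩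
    field_simp
    simp [hh]

lemma mkNice {p g : ℝ → ℝ} (hp : ContinuousOn p (Ici 0)) (hg : ContinuousOn g (Ici 0))
    (hp0 : ∀ s : ℝ, 0 ≤ s → 0 ≤ p s) (hm : MonotoneOn g (Ici 0)) (h0 : g 0 = 0) {B : ℝ}
    (hB : 0 ≤ B) :
    ∃ K, Nice (fun r => p (max 0 (min r 1))) (fun x => g (max 0 (min x B))) K := by
  obtain ⟨C, hC⟩ := (isCompact_Icc (a := (0:ℝ)) (b := 1)).exists_bound_of_continuousOn
    (hp.mono Icc_subset_Ici_self)
  have hg0 : ∀ x, 0 ≤ x → 0 ≤ g x := fun x hx => h0 ▸ hm (mem_Ici.2 le_rfl) hx hx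
  refine ⟨C * g B, ?_, ?_, fun x => hp0 _ (le_max_left _ _), fun x => hg0 _ (le_max_left _ _), ?_, ?_⟩
  · exact hp.comp_continuous (by fun_prop) (fun x => mem_Ici.2 (le_max_left _ _))
  · exact hg.comp_continuous (by fun_prop) (fun x => mem_Ici.2 (le_max_left _ _))
  · intro x y hxy
    exact hm (mem_Ici.2 (le_max_left _ _)) (mem_Ici.2 (le_max_left _ _)) (max_le_max le_rfl (min_le_min hxy le_rfl))
  · intro x y
    have h1 := hC (max 0 (min x 1)) ⟨le_max_left _ _, max_le zero_le_one (min_le_right _ _)⟩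
    exact mul_le_mul ((le_abs_self _).trans h1)
      (hm (mem_Ici.2 (le_max_left _ _)) hB (max_le hB (min_le_right _ _))) (hg0 _ (le_max_left _ _))
      ((norm_nonneg _).trans h1)

/-- Lemma: Local existence. -/
theorem local_existence
    (n : ℕ) (hn : 3 ≤ n) (f g p q : ℝ → ℝ)
    (hF1 : hypF1 f g)
    (hp : ContinuousOn p (Ici 0)) (hq : ContinuousOn q (Ici 0))
    (hp0 : ∀ s : ℝ, 0 ≤ s → 0 ≤ p s) (hq0 : ∀ s : ℝ, 0 ≤ s → 0 ≤ q s)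
    (a b : ℝ) (ha : 0 < a) (hb : 0 < b) :
    ∃ ρ : ℝ, 0 < ρ ∧ ∃ u v : ℝ → ℝ,
      IsRadODESol n p q f g a b ρ u v ∧
      ∀ r ∈ Ioo (0:ℝ) ρ, 0 ≤ deriv u r ∧ 0 ≤ deriv v r := by
  obtain ⟨hf, hg, -, -, mf, mg, f0, g0, -, -⟩ := hF1
  obtain ⟨m, rfl⟩ : ∃ m, n = m + 1 := ⟨n - 1, by omega⟩
  obtain ⟨K, H⟩ := mkNice hp hg hp0 mg g0 (B := 2 * b) (by linarith)
  obtain ⟨L, J⟩ := mkNice hq hf hq0 mf f0 (B := 2 * a) (by linarith)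
  obtain ⟨u, uc, hu⟩ := fixed m a b H J
  obtain ⟨v, hv⟩ : ∃ v, v = SS m b (fun r => q (max 0 (min r 1)))
    (fun x => f (max 0 (min x (2 * a)))) u := ⟨_, rfl⟩
  rw [← hv] at hu
  have vc : Continuous v := hv ▸ SS_cont m b J uc
  have u0 : u 0 = a := by rw [hu, SS_zero]
  have v0 : v 0 = b := by rw [hv, SS_zero]
  have ua : ∀ r, a ≤ u r := fun r => by rw [hu]; exact SS_ge m a H _ r
  have vb : ∀ r, b ≤ v r := fun r => by rw [hv]; exact SS_ge m b J _ r
  obtain ⟨cu, du, eu⟩ := SS_props m a H vc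
  obtain ⟨cv, dv, ev⟩ := SS_props m b J uc
  rw [← hu] at cu du eu
  rw [← hv] at cv dv ev
  have e1 : ∀ᶠ r in 𝓝 (0:ℝ), u r < 2 * a :=
    uc.continuousAt.eventually_lt continuousAt_const (by linarith)
  have e2 : ∀ᶠ r in 𝓝 (0:ℝ), v r < 2 * b :=
    vc.continuousAt.eventually_lt continuousAt_const (by linarith)
  obtain ⟨ε, hε, he⟩ := Metric.eventually_nhds_iff.1 (e1.and e2)
  refine ⟨min ε 1, lt_min hε one_pos, u, v, ⟨cu.contDiffOn, cv.contDiffOn,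
    fun r _ => ⟨ha.trans_le (ua r), hb.trans_le (vb r)⟩, u0, v0, du, dv, ?_⟩,
    fun r hr => ⟨(eu r hr.1).1, (ev r hr.1).1⟩⟩
  intro r hr
  have hr1 : r < 1 := hr.2.trans_le (min_le_right _ _)
  obtain ⟨h1, h2⟩ := he (y := r) (by
    rw [Real.dist_eq, sub_zero, abs_of_pos hr.1]
    exact hr.2.trans_le (min_le_left _ _))
  have hu' := (eu r hr.1).2
  have hv' := (ev r hr.1).2
  simp only [min_eq_left hr1.le, max_eq_right hr.1.le, min_eq_left h1.le, min_eq_left h2.le,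
    max_eq_right (ha.le.trans (ua r)), max_eq_right (hb.le.trans (vb r))] at hu' hv'
  push_cast
  simp only [add_sub_cancel_right]
  exact ⟨hu', hv'⟩
end

section
/- Let a, b > 0 and let R_{a,b} := sup{ρ > 0 : there is a positive solution of the radial system on [0,ρ) with u(0)=a, v(0)=b, u'(0)=v'(0)=0}. If R_{a,b} < ∞, then for the corresponding maximal solution (u,v) one has u(r) → ∞ and v(r) → ∞ as r ↑ R_{a,b}. -/
open MeasureTheory Set Filter Topology

noncomputable def mK (k : ℕ) (h : ℝ → ℝ) (r : ℝ) : ℝ := ∫ τ in (0:ℝ)..1, τ ^ k * h (r * τ)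
noncomputable def rK (k : ℕ) (h : ℝ → ℝ) (r : ℝ) : ℝ := ∫ t in (0:ℝ)..r, t * mK k h t

open scoped ENNReal in
noncomputable def mE (k : ℕ) (H : ℝ → ℝ≥0∞) (t : ℝ) : ℝ≥0∞ :=
  ∫⁻ τ in Ioc (0:ℝ) 1, ENNReal.ofReal (τ ^ k) * H (t * τ)
open scoped ENNReal in
noncomputable def kE (k : ℕ) (H : ℝ → ℝ≥0∞) (r : ℝ) : ℝ≥0∞ :=
  ∫⁻ t in Ioc (0:ℝ) r, ENNReal.ofReal t * mE k H t
open scoped ENNReal in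
noncomputable def gE (g : ℝ → ℝ) (x : ℝ≥0∞) : ℝ≥0∞ :=
  if x = ⊤ then ⊤ else ENNReal.ofReal (g x.toReal)

lemma mK_cont (k : ℕ) {h : ℝ → ℝ} (hh : Continuous h) : Continuous (mK k h) := by
  unfold mK
  apply intervalIntegral.continuous_parametric_intervalIntegral_of_continuous'
  fun_prop

lemma mK_mul (k : ℕ) (h : ℝ → ℝ) (r : ℝ) :
    r ^ (k+1) * mK k h r = ∫ s in (0:ℝ)..r, s ^ k * h s := by
  have := intervalIntegral.mul_integral_comp_mul_left (a := 0) (b := 1) (f := fun s => s ^ k * h s) (c := r)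
  simp only [mul_zero, mul_one] at this
  rw [← this]
  unfold mK
  rw [pow_succ', mul_assoc, ← intervalIntegral.integral_const_mul]
  congr 2
  ext τ
  ring

lemma mK_zero (k : ℕ) (h : ℝ → ℝ) : (k + 1) * mK k h 0 = h 0 := by
  unfold mK
  simp only [zero_mul, intervalIntegral.integral_mul_const, integral_pow]
  have : (k:ℝ) + 1 ≠ 0 := by positivity
  field_simp
  simp

lemma rmK_deriv (j : ℕ) {h : ℝ → ℝ} (hh : Continuous h) (r : ℝ) :
    HasDerivAt (fun t => t * mK (j+1) h t) (h r - (j + 1) * mK (j+1) h r) r := by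
  by_cases hr : r = 0
  · subst hr
    have h0 := mK_zero (j+1) h
    rw [hasDerivAt_iff_tendsto_slope]
    have hc : Tendsto (mK (j+1) h) (𝓝[≠] 0) (𝓝 (mK (j+1) h 0)) :=
      ((mK_cont (j+1) hh).tendsto 0).mono_left nhdsWithin_le_nhds
    have e : h 0 - (j + 1) * mK (j+1) h 0 = mK (j+1) h 0 := by
      push_cast at h0; linarith
    rw [e]
    refine hc.congr' ?_
    filter_upwards [self_mem_nhdsWithin] with t ht
    have ht : t ≠ 0 := ht
    simp [slope, ht]
  · have hI : HasDerivAt (fun r => ∫ s in (0:ℝ)..r, s ^ (j+1) * h s) (r ^ (j+1) * h r) r := by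
      have hc : Continuous (fun s : ℝ => s ^ (j+1) * h s) := by fun_prop
      exact intervalIntegral.integral_hasDerivAt_right (hc.intervalIntegrable _ _)
        (hc.stronglyMeasurableAtFilter _ _) hc.continuousAt
    have hD := hI.div (hasDerivAt_pow (j+1) r) (pow_ne_zero _ hr)
    have : (fun t => t * mK (j+1) h t) =ᶠ[𝓝 r]
        ((fun r => ∫ s in (0:ℝ)..r, s ^ (j+1) * h s) / fun x => x ^ (j+1)) := by
      filter_upwards [isOpen_ne.mem_nhds hr] with t ht
      have ht : t ≠ 0 := ht
      simp only [Pi.div_apply]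
      rw [← mK_mul]
      field_simp
      ring
    refine (hD.congr_of_eventuallyEq this).congr_deriv ?_
    rw [← mK_mul]
    simp only [Nat.add_sub_cancel]
    push_cast
    field_simp
    ring

lemma rK_deriv (k : ℕ) {h : ℝ → ℝ} (hh : Continuous h) (r : ℝ) :
    HasDerivAt (rK k h) (r * mK k h r) r := by
  have hc : Continuous (fun s : ℝ => s * mK k h s) := by
    have := mK_cont k hh
    fun_prop
  exact intervalIntegral.integral_hasDerivAt_right (hc.intervalIntegrable _ _)
        (hc.stronglyMeasurableAtFilter _ _) hc.continuousAt

lemma rK_deriv_eq (k : ℕ) {h : ℝ → ℝ} (hh : Continuous h) :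
    deriv (rK k h) = fun r => r * mK k h r := funext fun r => (rK_deriv k hh r).deriv

lemma rK_contDiff (j : ℕ) {h : ℝ → ℝ} (hh : Continuous h) : ContDiff ℝ 2 (rK (j+1) h) := by
  have h2 : ContDiff ℝ 1 (fun r => r * mK (j+1) h r) := by
    rw [contDiff_one_iff_deriv]
    refine ⟨fun r => (rmK_deriv j hh r).differentiableAt, ?_⟩
    have : deriv (fun r => r * mK (j+1) h r) = fun r => h r - (j + 1) * mK (j+1) h r :=
      funext fun r => (rmK_deriv j hh r).deriv
    rw [this]
    have := mK_cont (j+1) hh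
    fun_prop
  have : (2 : WithTop ℕ∞) = 1 + 1 := by norm_num
  rw [this, contDiff_succ_iff_deriv]
  refine ⟨fun r => (rK_deriv _ hh r).differentiableAt, by simp, ?_⟩
  rw [rK_deriv_eq _ hh]
  exact h2

lemma rK_zero (k : ℕ) (h : ℝ → ℝ) : rK k h 0 = 0 := by simp [rK]

lemma mK_nonneg (k : ℕ) {h : ℝ → ℝ} (h0 : ∀ s, 0 ≤ h s) (r : ℝ) : 0 ≤ mK k h r := by
  unfold mK
  apply intervalIntegral.integral_nonneg (by norm_num)
  intro τ hτ
  exact mul_nonneg (pow_nonneg hτ.1 _) (h0 _)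

lemma mE_eq (k : ℕ) {h : ℝ → ℝ} (hh : Continuous h) (h0 : ∀ s, 0 ≤ h s) (H : ℝ → ENNReal) (t r : ℝ)
    (ht : t ∈ Ioc 0 r) (hH : ∀ s ∈ Ioc 0 r, H s = ENNReal.ofReal (h s)) :
    mE k H t = ENNReal.ofReal (mK k h t) := by
  unfold mE mK
  have hc : Continuous (fun τ : ℝ => τ ^ k * h (t * τ)) := by fun_prop
  rw [intervalIntegral.integral_of_le (by norm_num), ofReal_integral_eq_lintegral_ofReal]
  · apply setLIntegral_congr_fun measurableSet_Ioc
    intro τ hτ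
    simp only
    rw [hH, ENNReal.ofReal_mul (pow_nonneg hτ.1.le _)]
    exact ⟨mul_pos ht.1 hτ.1, by nlinarith [hτ.1, hτ.2, ht.1, ht.2]⟩
  · exact hc.integrableOn_Ioc
  · filter_upwards [ae_restrict_mem measurableSet_Ioc] with τ hτ
    exact mul_nonneg (pow_nonneg hτ.1.le _) (h0 _)

lemma kE_eq (k : ℕ) {h : ℝ → ℝ} (hh : Continuous h) (h0 : ∀ s, 0 ≤ h s) (H : ℝ → ENNReal) (r : ℝ)
    (hr : 0 ≤ r) (hH : ∀ s ∈ Ioc 0 r, H s = ENNReal.ofReal (h s)) :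
    kE k H r = ENNReal.ofReal (rK k h r) := by
  unfold kE rK
  have hc : Continuous (fun t : ℝ => t * mK k h t) := by
    have := mK_cont k hh
    fun_prop
  rw [intervalIntegral.integral_of_le hr, ofReal_integral_eq_lintegral_ofReal]
  · apply setLIntegral_congr_fun measurableSet_Ioc
    intro t ht
    simp only
    rw [mE_eq k hh h0 H t r ht hH, ENNReal.ofReal_mul ht.1.le]
  · exact hc.integrableOn_Ioc
  · filter_upwards [ae_restrict_mem measurableSet_Ioc] with t ht
    exact mul_nonneg ht.1.le (mK_nonneg k h0 _)

lemma mE_le (k : ℕ) (H : ℝ → ENNReal) (C : ENNReal) (t r : ℝ) (ht : t ∈ Ioc 0 r)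
    (hH : ∀ s ∈ Ioc 0 r, H s ≤ C) : mE k H t ≤ C := by
  unfold mE
  calc _ ≤ ∫⁻ τ in Ioc (0:ℝ) 1, C := by
        apply setLIntegral_mono' measurableSet_Ioc
        intro τ hτ
        have h1 : ENNReal.ofReal (τ ^ k) ≤ 1 := by
          rw [ENNReal.ofReal_le_one]
          exact pow_le_one₀ hτ.1.le hτ.2
        calc _ ≤ 1 * C := mul_le_mul' h1 (hH _ ⟨mul_pos ht.1 hτ.1, by nlinarith [hτ.1, hτ.2, ht.1, ht.2]⟩)
          _ = C := one_mul _
    _ = C := by simp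

lemma kE_mono_r (k : ℕ) (H : ℝ → ENNReal) : Monotone (kE k H) := by
  intro r s hrs
  unfold kE
  exact lintegral_mono_set (Ioc_subset_Ioc_right hrs)

lemma kE_mono (k : ℕ) {H H' : ℝ → ENNReal} (hH : ∀ s, H s ≤ H' s) (r : ℝ) : kE k H r ≤ kE k H' r := by
  unfold kE mE
  gcongr
  exact hH _

lemma kE_congr (k : ℕ) {H H' : ℝ → ENNReal} (r : ℝ) (hH : ∀ s ∈ Ioc 0 r, H s = H' s) :
    kE k H r = kE k H' r := by
  unfold kE mE
  apply setLIntegral_congr_fun measurableSet_Ioc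
  intro t ht
  simp only
  congr 1
  apply setLIntegral_congr_fun measurableSet_Ioc
  intro τ hτ
  simp only
  rw [hH]
  exact ⟨mul_pos ht.1 hτ.1, by nlinarith [hτ.1, hτ.2, ht.1, ht.2]⟩

lemma kE_add_le (k : ℕ) (H : ℝ → ENNReal) (C : ENNReal) (r s : ℝ) (hr : 0 ≤ r) (hrs : r ≤ s)
    (hH : ∀ x ∈ Ioc 0 s, H x ≤ C) :
    kE k H s ≤ kE k H r + ENNReal.ofReal s * C * ENNReal.ofReal (s - r) := by
  unfold kE
  rw [← Ioc_union_Ioc_eq_Ioc hr hrs, lintegral_union measurableSet_Ioc (Ioc_disjoint_Ioc_of_le le_rfl)]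
  gcongr
  calc _ ≤ ∫⁻ t in Ioc r s, ENNReal.ofReal s * C := by
        apply setLIntegral_mono' measurableSet_Ioc
        intro t ht
        gcongr
        · exact ht.2
        · exact mE_le k H C t s ⟨hr.trans_lt ht.1, ht.2⟩ hH
    _ = _ := by simp

lemma gE_mono {g : ℝ → ℝ} (hg : MonotoneOn g (Ici 0)) : Monotone (gE g) := by
  intro x y hxy
  unfold gE
  by_cases hy : y = ⊤
  · simp [hy]
  · have hx : x ≠ ⊤ := ne_top_of_le_ne_top hy hxy
    simp only [hx, hy, if_false]
    apply ENNReal.ofReal_le_ofReal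
    exact hg ENNReal.toReal_nonneg ENNReal.toReal_nonneg (ENNReal.toReal_mono hy hxy)

lemma gE_ofReal (g : ℝ → ℝ) {x : ℝ} (hx : 0 ≤ x) : gE g (ENNReal.ofReal x) = ENNReal.ofReal (g x) := by
  simp [gE, ENNReal.toReal_ofReal hx]

lemma const_of_deriv_zero {f : ℝ → ℝ} {x : ℝ} (hx : 0 < x) (hc : ContinuousOn f (Icc 0 x))
    (hd : ∀ y ∈ Ioo 0 x, HasDerivAt f 0 y) : f x = f 0 := by
  obtain ⟨c, _, h⟩ := exists_hasDerivAt_eq_slope f (fun _ => 0) hx hc hd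
  have : x - 0 ≠ 0 := by linarith
  field_simp at h
  linarith

lemma old_eq (j : ℕ) {u h : ℝ → ℝ} (R r0 : ℝ) (hr : r0 < R) (hu : ContDiffOn ℝ 2 u (Ico 0 R))
    (hh : Continuous h)
    (hode : ∀ r ∈ Ioo 0 r0, deriv (deriv u) r + ((j:ℝ)+1) / r * deriv u r = h r) :
    ∀ r ∈ Icc 0 r0, u r = u 0 + rK (j+1) h r := by
  have hmc := mK_cont (j+1) hh
  set D := derivWithin u (Ico 0 R) with hDdef
  have hDc : ContinuousOn D (Ico 0 R) :=
    hu.continuousOn_derivWithin (uniqueDiffOn_Ico 0 R) (by norm_num)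
  have hnh : ∀ r ∈ Ioo 0 R, Ico 0 R ∈ 𝓝 r := fun r hr => Ico_mem_nhds hr.1 hr.2
  have hDe : ∀ r ∈ Ioo 0 R, D r = deriv u r := fun r hr => derivWithin_of_mem_nhds (hnh r hr)
  have hu1 : ∀ r ∈ Ioo 0 R, HasDerivAt u (D r) r := by
    intro r hr
    rw [hDe r hr]
    have : ContDiffAt ℝ 2 u r := hu.contDiffAt (hnh r hr)
    exact (this.differentiableAt (by norm_num)).hasDerivAt
  have hD1 : ∀ r ∈ Ioo 0 R, HasDerivAt D (deriv (deriv u) r) r := by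
    intro r hr
    have h2 : ContDiffOn ℝ 1 (deriv u) (Ioo 0 R) :=
      (hu.mono Ioo_subset_Ico_self).deriv_of_isOpen isOpen_Ioo (by norm_num)
    have h3 := ((h2.contDiffAt (isOpen_Ioo.mem_nhds hr)).differentiableAt (by norm_num)).hasDerivAt
    refine h3.congr_of_eventuallyEq ?_
    filter_upwards [isOpen_Ioo.mem_nhds hr] with t ht using hDe t ht
  have hz : ∀ r ∈ Ioc 0 r0, D r = r * mK (j+1) h r := by
    intro r hr1
    have := const_of_deriv_zero (f := fun t => t ^ (j+1) * (D t - t * mK (j+1) h t)) hr1.1 ?_ ?_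
    · have h0 : (0:ℝ) ^ (j+1) = 0 := by simp
      simp only [h0, zero_mul] at this
      have hp : r ^ (j+1) ≠ 0 := pow_ne_zero _ hr1.1.ne'
      have := (mul_eq_zero.1 this).resolve_left hp
      linarith
    · have : ContinuousOn D (Icc 0 r) := hDc.mono fun t ht => ⟨ht.1, by linarith [ht.2, hr1.2]⟩
      fun_prop
    · intro t ht
      have htR : t ∈ Ioo 0 R := ⟨ht.1, by linarith [ht.2, hr1.2]⟩
      have htr : t ∈ Ioo 0 r0 := ⟨ht.1, by linarith [ht.2, hr1.2]⟩
      have hd := (hasDerivAt_pow (j+1) t).mul ((hD1 t htR).sub (rmK_deriv j hh t))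
      refine hd.congr_deriv ?_
      have ho := hode t htr
      rw [← hDe t htR] at ho
      have ht0 : t ≠ 0 := ht.1.ne'
      have e : deriv (deriv u) t = h t - ((j:ℝ)+1) / t * D t := by linarith
      rw [e]
      simp only [Nat.add_sub_cancel, Pi.sub_apply]
      push_cast
      field_simp
      ring
  intro r hr1
  rcases hr1.1.eq_or_lt with h0 | h0
  · rw [← h0, rK_zero, add_zero]
  have := const_of_deriv_zero (f := fun t => u t - rK (j+1) h t) h0 ?_ ?_
  · simp only [rK_zero] at this
    linarith
  · have h1 : ContinuousOn u (Icc 0 r) := hu.continuousOn.mono fun t ht => ⟨ht.1, by linarith [ht.2, hr1.2]⟩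
    have h2 : Continuous (rK (j+1) h) := (rK_contDiff j hh).continuous
    fun_prop
  · intro t ht
    have htR : t ∈ Ioo 0 R := ⟨ht.1, by linarith [ht.2, hr1.2]⟩
    refine ((hu1 t htR).sub (rK_deriv (j+1) hh t)).congr_deriv ?_
    rw [hz t ⟨ht.1, by linarith [ht.2, hr1.2]⟩]
    ring

lemma kE_cont (k : ℕ) (H : ℝ → ENNReal) (C : ENNReal) (hC : C ≠ ⊤) (a T : ℝ) (hT : 0 < T)
    (hH : ∀ x ∈ Ioc 0 T, H x ≤ C) (hfin : kE k H T ≠ ⊤) :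
    ContinuousOn (fun r => (ENNReal.ofReal a + kE k H r).toReal) (Icc 0 T) := by
  have hf : ∀ r ∈ Icc 0 T, kE k H r ≠ ⊤ := fun r hr => ne_top_of_le_ne_top hfin (kE_mono_r k H hr.2)
  have hL : LipschitzOnWith (Real.toNNReal T * C.toNNReal)
      (fun r => (ENNReal.ofReal a + kE k H r).toReal) (Icc 0 T) := by
    apply LipschitzOnWith.of_le_add_mul
    intro x hx y hy
    rw [ENNReal.toReal_add ENNReal.ofReal_ne_top (hf x hx), ENNReal.toReal_add ENNReal.ofReal_ne_top (hf y hy)]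
    rcases le_total x y with hxy | hxy
    · have := ENNReal.toReal_mono (hf y hy) (kE_mono_r k H hxy)
      have : 0 ≤ ((Real.toNNReal T * C.toNNReal : NNReal) : ℝ) * dist x y := by positivity
      linarith
    · have h1 := kE_add_le k H C y x hy.1 hxy (fun z hz => hH z ⟨hz.1, hz.2.trans hx.2⟩)
      have h2 : kE k H x ≤ kE k H y + ENNReal.ofReal T * C * ENNReal.ofReal (x - y) := by
        refine h1.trans ?_
        gcongr
        exact hx.2
      have hne : ENNReal.ofReal T * C * ENNReal.ofReal (x - y) ≠ ⊤ :=
        ENNReal.mul_ne_top (ENNReal.mul_ne_top ENNReal.ofReal_ne_top hC) ENNReal.ofReal_ne_top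
      have h3 := ENNReal.toReal_mono (ENNReal.add_ne_top.2 ⟨hf y hy, hne⟩) h2
      rw [ENNReal.toReal_add (hf y hy) hne, ENNReal.toReal_mul, ENNReal.toReal_mul,
        ENNReal.toReal_ofReal hT.le, ENNReal.toReal_ofReal (by linarith)] at h3
      rw [Real.dist_eq, abs_of_nonneg (by linarith)]
      push_cast
      rw [Real.coe_toNNReal _ hT.le]
      linarith
  exact hL.continuousOn

/-- clamp -/
noncomputable def cl (T s : ℝ) : ℝ := max 0 (min s T)

lemma cl_cont (T : ℝ) : Continuous (cl T) := by unfold cl; fun_prop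
lemma cl_mem {T : ℝ} (hT : 0 ≤ T) (s : ℝ) : cl T s ∈ Icc 0 T := by
  unfold cl
  exact ⟨le_max_left _ _, max_le hT (min_le_right _ _)⟩
lemma cl_eq {T s : ℝ} (hs : s ∈ Icc 0 T) : cl T s = s := by
  unfold cl
  rw [min_eq_left hs.2, max_eq_right hs.1]

lemma clamp_cont {g p v : ℝ → ℝ} {T : ℝ} (hT : 0 ≤ T) (hg : ContinuousOn g (Ici 0))
    (hp : ContinuousOn p (Ici 0))
    (hv : ContinuousOn v (Icc 0 T)) (hv0 : ∀ r ∈ Icc 0 T, 0 ≤ v r) :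
    Continuous (fun s => p (cl T s) * g (v (cl T s))) := by
  have h1 : Continuous (fun s => p (cl T s)) :=
    hp.comp_continuous (cl_cont T) (fun s => (cl_mem hT s).1)
  have h2 : Continuous (fun s => v (cl T s)) := hv.comp_continuous (cl_cont T) (cl_mem hT)
  have h3 : Continuous (fun s => g (v (cl T s))) :=
    hg.comp_continuous h2 (fun s => hv0 _ (cl_mem hT s))
  exact h1.mul h3

noncomputable def PhiOp (k : ℕ) (p g : ℝ → ℝ) (a : ℝ) (V : ℝ → ENNReal) (r : ℝ) : ENNReal :=
  ENNReal.ofReal a + kE k (fun s => ENNReal.ofReal (p s) * gE g (V s)) r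

lemma PhiOp_mono_r (k : ℕ) (p g : ℝ → ℝ) (a : ℝ) (V : ℝ → ENNReal) : Monotone (PhiOp k p g a V) := by
  intro r s hrs
  unfold PhiOp
  gcongr
  exact kE_mono_r _ _ hrs

lemma PhiOp_mono (k : ℕ) {p g : ℝ → ℝ} (hg : MonotoneOn g (Ici 0)) (a : ℝ) {V W : ℝ → ENNReal}
    (h : ∀ s, V s ≤ W s) (r : ℝ) : PhiOp k p g a V r ≤ PhiOp k p g a W r := by
  unfold PhiOp
  gcongr
  apply kE_mono
  intro s
  gcongr
  exact gE_mono hg (h s)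

lemma fixed_exists (k : ℕ) {p q f g : ℝ → ℝ} (hf : MonotoneOn f (Ici 0)) (hg : MonotoneOn g (Ici 0))
    (a b : ℝ) (S1 S2 : ℝ → ENNReal) (hm1 : Monotone S1) (hm2 : Monotone S2)
    (hS1 : ∀ r, PhiOp k p g a S2 r ≤ S1 r) (hS2 : ∀ r, PhiOp k q f b S1 r ≤ S2 r) :
    ∃ U V : ℝ → ENNReal, Monotone U ∧ Monotone V ∧ (∀ r, U r ≤ S1 r) ∧ (∀ r, V r ≤ S2 r) ∧
      (∀ r, U r = PhiOp k p g a V r) ∧ (∀ r, V r = PhiOp k q f b U r) := by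
  let Φ : ((ℝ →o ENNReal) × (ℝ →o ENNReal)) →o ((ℝ →o ENNReal) × (ℝ →o ENNReal)) :=
    { toFun := fun X => (⟨PhiOp k p g a X.2, PhiOp_mono_r _ _ _ _ _⟩,
        ⟨PhiOp k q f b X.1, PhiOp_mono_r _ _ _ _ _⟩)
      monotone' := fun X Y h => ⟨fun r => PhiOp_mono k hg a (fun s => h.2 s) r,
        fun r => PhiOp_mono k hf b (fun s => h.1 s) r⟩ }
  have hle : OrderHom.lfp Φ ≤ ((⟨S1, hm1⟩, ⟨S2, hm2⟩) : (ℝ →o ENNReal) × (ℝ →o ENNReal)) :=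
    OrderHom.lfp_le Φ ⟨hS1, hS2⟩
  have hfix := OrderHom.map_lfp Φ
  refine ⟨(OrderHom.lfp Φ).1, (OrderHom.lfp Φ).2, (OrderHom.lfp Φ).1.monotone,
    (OrderHom.lfp Φ).2.monotone, fun r => hle.1 r, fun r => hle.2 r, fun r => ?_, fun r => ?_⟩
  · conv_lhs => rw [← hfix]
    rfl
  · conv_lhs => rw [← hfix]
    rfl

lemma fixed_cont (k : ℕ) {p g : ℝ → ℝ} (hg : MonotoneOn g (Ici 0)) (hp : ContinuousOn p (Ici 0))
    (a T : ℝ) (hT : 0 < T) (U V : ℝ → ENNReal) (hV : Monotone V)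
    (hU : ∀ r, U r = PhiOp k p g a V r) (hUT : U T ≠ ⊤) (hVT : V T ≠ ⊤) :
    ContinuousOn (fun r => (U r).toReal) (Icc 0 T) := by
  obtain ⟨C, hC⟩ := (isCompact_Icc (a := (0:ℝ)) (b := T)).bddAbove_image (hp.mono Icc_subset_Ici_self)
  have hfin : kE k (fun s => ENNReal.ofReal (p s) * gE g (V s)) T ≠ ⊤ := by
    rw [hU] at hUT
    exact (ENNReal.add_ne_top.1 hUT).2
  have := kE_cont k (fun s => ENNReal.ofReal (p s) * gE g (V s)) (ENNReal.ofReal C * gE g (V T))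
    (ENNReal.mul_ne_top ENNReal.ofReal_ne_top (by simp [gE, hVT])) a T hT ?_ hfin
  · refine this.congr ?_
    intro r hr
    simp only [hU r, PhiOp]
  · intro x hx
    gcongr
    · exact hC ⟨x, ⟨hx.1.le, hx.2⟩, rfl⟩
    · exact gE_mono hg (hV hx.2)

lemma fixed_rep (k : ℕ) {p g : ℝ → ℝ} (hgc : ContinuousOn g (Ici 0))
    (hg0 : ∀ s, 0 ≤ s → 0 ≤ g s) (hp : ContinuousOn p (Ici 0)) (hp0 : ∀ s : ℝ, 0 ≤ s → 0 ≤ p s)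
    (a T : ℝ) (ha : 0 < a) (hT : 0 < T) (U V : ℝ → ENNReal) (hV : Monotone V)
    (hU : ∀ r, U r = PhiOp k p g a V r) (hVT : V T ≠ ⊤)
    (hVc : ContinuousOn (fun r => (V r).toReal) (Icc 0 T)) :
    ∃ h : ℝ → ℝ, Continuous h ∧ (∀ s, 0 ≤ h s) ∧ (∀ s ∈ Icc 0 T, h s = p s * g ((V s).toReal)) ∧
      ∀ r ∈ Icc 0 T, (U r).toReal = a + rK k h r := by
  have hn : ∀ s, 0 ≤ p (cl T s) * g ((V (cl T s)).toReal) := fun s =>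
    mul_nonneg (hp0 _ (cl_mem hT.le s).1) (hg0 _ ENNReal.toReal_nonneg)
  have hcc := clamp_cont (v := fun r => (V r).toReal) hT.le hgc hp hVc
      (fun _ _ => ENNReal.toReal_nonneg)
  refine ⟨fun s => p (cl T s) * g ((V (cl T s)).toReal), hcc, hn, ?_, ?_⟩
  · intro s hs
    simp only [cl_eq hs]
  · intro r hr
    rw [hU, PhiOp, kE_eq k hcc hn _ r hr.1, ← ENNReal.ofReal_add ha.le, ENNReal.toReal_ofReal]
    · have : 0 ≤ rK k (fun s => p (cl T s) * g ((V (cl T s)).toReal)) r := by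
        unfold rK
        exact intervalIntegral.integral_nonneg hr.1 fun t ht => mul_nonneg ht.1 (mK_nonneg k hn t)
      linarith
    · unfold rK
      exact intervalIntegral.integral_nonneg hr.1 fun t ht => mul_nonneg ht.1 (mK_nonneg k hn t)
    · intro s hs
      have hs' : s ∈ Icc 0 T := ⟨hs.1.le, hs.2.trans hr.2⟩
      have hVs : V s ≠ ⊤ := ne_top_of_le_ne_top hVT (hV hs'.2)
      simp only [cl_eq hs', gE, hVs, if_false]
      rw [ENNReal.ofReal_mul (hp0 _ hs.1.le)]

lemma rK_nonneg (k : ℕ) {h : ℝ → ℝ} (hn : ∀ s, 0 ≤ h s) {r : ℝ} (hr : 0 ≤ r) : 0 ≤ rK k h r := by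
  unfold rK
  exact intervalIntegral.integral_nonneg hr fun t ht => mul_nonneg ht.1 (mK_nonneg k hn t)

lemma sol_of_super (j : ℕ) (f g p q : ℝ → ℝ)
    (hF1 : hypF1 f g)
    (hp : ContinuousOn p (Ici 0)) (hq : ContinuousOn q (Ici 0))
    (hp0 : ∀ s : ℝ, 0 ≤ s → 0 ≤ p s) (hq0 : ∀ s : ℝ, 0 ≤ s → 0 ≤ q s)
    (a b : ℝ) (ha : 0 < a) (hb : 0 < b) (T : ℝ) (hT : 0 < T)
    (S1 S2 : ℝ → ENNReal) (hm1 : Monotone S1) (hm2 : Monotone S2)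
    (hS1 : ∀ r, PhiOp (j+1) p g a S2 r ≤ S1 r) (hS2 : ∀ r, PhiOp (j+1) q f b S1 r ≤ S2 r)
    (h1T : S1 T ≠ ⊤) (h2T : S2 T ≠ ⊤) : ∃ u v, IsRadODESol (j+2) p q f g a b T u v := by
  obtain ⟨hfc, hgc, -, -, hfm, hgm, hf0, hg0, hfp, hgp⟩ := hF1
  have hf0 : ∀ s, 0 ≤ s → 0 ≤ f s := fun s hs => by
    rw [← hf0]; exact hfm self_mem_Ici hs hs
  have hg0 : ∀ s, 0 ≤ s → 0 ≤ g s := fun s hs => by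
    rw [← hg0]; exact hgm self_mem_Ici hs hs
  obtain ⟨U, V, hU, hV, hU1, hV1, hU2, hV2⟩ := fixed_exists (j+1) hfm hgm a b S1 S2 hm1 hm2 hS1 hS2
  have hUT := ne_top_of_le_ne_top h1T (hU1 T)
  have hVT := ne_top_of_le_ne_top h2T (hV1 T)
  have hUc := fixed_cont (j+1) hgm hp a T hT U V hV hU2 hUT hVT
  have hVc := fixed_cont (j+1) hfm hq b T hT V U hU hV2 hVT hUT
  obtain ⟨h1, c1, n1, e1, r1⟩ := fixed_rep (j+1) hgc hg0 hp hp0 a T ha hT U V hV hU2 hVT hVc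
  obtain ⟨h2, c2, n2, e2, r2⟩ := fixed_rep (j+1) hfc hf0 hq hq0 b T hb hT V U hU hV2 hUT hUc
  have key : ∀ (c : ℝ) (h : ℝ → ℝ), Continuous h →
      deriv (fun r => c + rK (j+1) h r) = fun r => r * mK (j+1) h r := by
    intro c h hh
    funext r
    exact ((rK_deriv (j+1) hh r).const_add c).deriv
  have key2 : ∀ (h : ℝ → ℝ), Continuous h → ∀ r : ℝ, 0 < r →
     h r - (j + 1) * mK (j+1) h r + (((j+2 : ℕ) : ℝ) - 1) / r * (r * mK (j+1) h r) = h r := by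
    intro h hh r hr
    push_cast
    field_simp
    ring
  refine ⟨fun r => a + rK (j+1) h1 r, fun r => b + rK (j+1) h2 r,
    (contDiff_const.add (rK_contDiff j c1)).contDiffOn, (contDiff_const.add (rK_contDiff j c2)).contDiffOn,
    ?_, by simp [rK_zero], by simp [rK_zero], ?_, ?_, ?_⟩
  · intro r hr
    have := rK_nonneg (j+1) n1 hr.1
    have := rK_nonneg (j+1) n2 hr.1
    constructor <;> linarith
  · rw [key a h1 c1]; simp
  · rw [key b h2 c2]; simp
  · intro r hr
    have hr' : r ∈ Icc 0 T := ⟨hr.1.le, hr.2.le⟩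
    rw [key a h1 c1, key b h2 c2, (rmK_deriv j c1 r).deriv, (rmK_deriv j c2 r).deriv, key2 h1 c1 r hr.1,
      key2 h2 c2 r hr.1, e1 r hr', e2 r hr', r1 r hr', r2 r hr']
    exact ⟨rfl, rfl⟩

lemma old_rep (j : ℕ) {u v p g : ℝ → ℝ} (hgc : ContinuousOn g (Ici 0))
    (hg0 : ∀ s, 0 ≤ s → 0 ≤ g s) (hp : ContinuousOn p (Ici 0)) (hp0 : ∀ s : ℝ, 0 ≤ s → 0 ≤ p s)
    (a R : ℝ) (ha : 0 < a) (hu : ContDiffOn ℝ 2 u (Ico 0 R)) (hv : ContinuousOn v (Ico 0 R))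
    (hv0 : ∀ r ∈ Ico 0 R, 0 ≤ v r) (hua : u 0 = a)
    (hode : ∀ r ∈ Ioo 0 R, deriv (deriv u) r + (((j+2 : ℕ) : ℝ) - 1) / r * deriv u r = p r * g (v r)) :
    ∀ r ∈ Ico 0 R, ENNReal.ofReal (u r) = PhiOp (j+1) p g a (fun s => ENNReal.ofReal (v s)) r := by
  intro r hr
  have hsub : Icc 0 r ⊆ Ico 0 R := fun t ht => ⟨ht.1, ht.2.trans_lt hr.2⟩
  have hcc := clamp_cont (v := v) hr.1 hgc hp (hv.mono hsub) (fun t ht => hv0 t (hsub ht))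
  have hn : ∀ s, 0 ≤ p (cl r s) * g (v (cl r s)) := fun s =>
    mul_nonneg (hp0 _ (cl_mem hr.1 s).1) (hg0 _ (hv0 _ (hsub (cl_mem hr.1 s))))
  have h1 := old_eq j R r hr.2 hu hcc (by
    intro t ht
    have := hode t ⟨ht.1, ht.2.trans hr.2⟩
    simp only [cl_eq (T := r) ⟨ht.1.le, ht.2.le⟩]
    rw [← this]
    push_cast
    ring) r ⟨hr.1, le_rfl⟩
  rw [h1, hua, PhiOp, kE_eq (j+1) hcc hn _ r hr.1, ENNReal.ofReal_add ha.le (rK_nonneg _ hn hr.1)]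
  intro s hs
  have hs' : s ∈ Icc 0 r := ⟨hs.1.le, hs.2⟩
  simp only [cl_eq hs']
  rw [gE_ofReal g (hv0 s (hsub hs')), ENNReal.ofReal_mul (hp0 s hs.1.le)]

lemma old_mono {k : ℕ} {u v p g : ℝ → ℝ} {a R : ℝ} (hu0 : ∀ r ∈ Ico 0 R, 0 < u r)
    (hrep : ∀ r ∈ Ico 0 R, ENNReal.ofReal (u r) = PhiOp k p g a (fun s => ENNReal.ofReal (v s)) r) :
    MonotoneOn u (Ico 0 R) := by
  intro r hr s hs hrs
  rw [← ENNReal.ofReal_le_ofReal_iff (hu0 s hs).le, hrep r hr, hrep s hs]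
  exact PhiOp_mono_r _ _ _ _ _ hrs

lemma old_bdd {k : ℕ} {u v p g : ℝ → ℝ} {a R M : ℝ}
    (hgm : MonotoneOn g (Ici 0)) (hp : ContinuousOn p (Ici 0))
    (hv0 : ∀ r ∈ Ico 0 R, 0 < v r)
    (hrep : ∀ r ∈ Ico 0 R, ENNReal.ofReal (u r) = PhiOp k p g a (fun s => ENNReal.ofReal (v s)) r)
    (hM : ∀ r ∈ Ico 0 R, v r ≤ M) : ∃ M', ∀ r ∈ Ico 0 R, u r ≤ M' := by
  obtain ⟨P, hP⟩ := (isCompact_Icc (a := (0:ℝ)) (b := R)).bddAbove_image (hp.mono Icc_subset_Ici_self)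
  set B : ENNReal := ENNReal.ofReal (u 0) + ENNReal.ofReal R * (ENNReal.ofReal P * ENNReal.ofReal (g M)) * ENNReal.ofReal R with hB
  have hBt : B ≠ ⊤ := by
    rw [hB]
    simp [ENNReal.mul_eq_top]
  refine ⟨B.toReal, fun r hr => ?_⟩
  rw [← ENNReal.ofReal_le_iff_le_toReal hBt, hrep r hr, hB, hrep 0 ⟨le_rfl, hr.1.trans_lt hr.2⟩]
  unfold PhiOp
  rw [add_assoc]
  gcongr
  refine (kE_add_le k _ (ENNReal.ofReal P * ENNReal.ofReal (g M)) 0 r le_rfl hr.1 ?_).trans ?_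
  · intro x hx
    have hx' : x ∈ Ico 0 R := ⟨hx.1.le, hx.2.trans_lt hr.2⟩
    rw [gE_ofReal g (hv0 x hx').le]
    gcongr
    · exact hP ⟨x, ⟨hx'.1, hx'.2.le⟩, rfl⟩
    · exact hgm (hv0 x hx').le ((hv0 x hx').le.trans (hM x hx')) (hM x hx')
  · gcongr
    · exact hr.2.le
    · linarith [hr.2]

lemma bdd_of_not {u : ℝ → ℝ} {R : ℝ} (hm : MonotoneOn u (Ico 0 R))
    (h : ¬ Tendsto u (𝓝[<] R) atTop) : ∃ M, ∀ r ∈ Ico 0 R, u r ≤ M := by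
  by_contra hc
  push Not at hc
  apply h
  rw [tendsto_atTop]
  intro M
  obtain ⟨r, hr, hM⟩ := hc M
  filter_upwards [Ioo_mem_nhdsLT hr.2] with t ht
  exact hM.le.trans (hm hr ⟨hr.1.trans ht.1.le, ht.2⟩ ht.1.le)

noncomputable def supS (u : ℝ → ℝ) (R M T r : ℝ) : ENNReal :=
  if r < R then ENNReal.ofReal (u (max r 0)) else if r ≤ T then ENNReal.ofReal (M + 1) else ⊤

lemma supS_mono {u : ℝ → ℝ} {R M T : ℝ} (hR : 0 < R) (hm : MonotoneOn u (Ico 0 R))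
    (hM : ∀ r ∈ Ico 0 R, u r ≤ M) : Monotone (supS u R M T) := by
  intro r s hrs
  have hmem : ∀ x, x < R → max x 0 ∈ Ico 0 R := fun x hx => ⟨le_max_right _ _, max_lt hx hR⟩
  unfold supS
  by_cases hs : s < R
  · have hr : r < R := hrs.trans_lt hs
    simp only [hs, hr, if_true]
    exact ENNReal.ofReal_le_ofReal (hm (hmem r hr) (hmem s hs) (max_le_max_right _ hrs))
  · by_cases hsT : s ≤ T
    · have hrT := hrs.trans hsT
      simp only [hs, hsT, hrT, if_true, if_false]
      split_ifs with hr
      · exact ENNReal.ofReal_le_ofReal (by linarith [hM _ (hmem r hr)])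
      · exact le_rfl
    · simp [hs, hsT]

lemma supS_super {k : ℕ} {u v p g : ℝ → ℝ} {a R M ε A : ℝ} (hR : 0 < R)
    (hgm : MonotoneOn g (Ici 0)) (hp0 : ∀ s : ℝ, 0 ≤ s → 0 ≤ p s)
    (hv0 : ∀ r ∈ Ico 0 R, 0 < v r) (hmv : MonotoneOn v (Ico 0 R))
    (hrep : ∀ r ∈ Ico 0 R, ENNReal.ofReal (u r) = PhiOp k p g a (fun s => ENNReal.ofReal (v s)) r)
    (hMv : ∀ r ∈ Ico 0 R, v r ≤ M) (hMu : ∀ r ∈ Ico 0 R, u r ≤ M) (hM : 0 ≤ M)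
    (hε : 0 < ε) (hε1 : ε ≤ 1) (hεR : ε ≤ R) (hA0 : 0 ≤ A)
    (hA : ∀ s ∈ Icc 0 (R+1), p s * g (M+1) ≤ A) (hεA : (R+1) * A * (2 * ε) ≤ 1) (r : ℝ) :
    PhiOp k p g a (supS v R M (R+ε)) r ≤ supS u R M (R+ε) r := by
  have hc : ∀ r ∈ Ico 0 R, PhiOp k p g a (supS v R M (R+ε)) r = ENNReal.ofReal (u r) := by
    intro r hr
    rw [hrep r hr]
    unfold PhiOp
    congr 1
    apply kE_congr
    intro s hs
    have : s < R := hs.2.trans_lt hr.2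
    simp [supS, this, max_eq_left hs.1.le]
  by_cases h1 : r < R
  · refine (PhiOp_mono_r k p g a _ (le_max_left r 0)).trans ?_
    rw [hc _ ⟨le_max_right _ _, max_lt h1 hR⟩]
    simp [supS, h1]
  by_cases h2 : r ≤ R + ε
  · have hS : supS u R M (R+ε) r = ENNReal.ofReal M + ENNReal.ofReal 1 := by
      rw [← ENNReal.ofReal_add hM zero_le_one]
      simp [supS, h1, h2]
    rw [hS]
    have hk := kE_add_le k (fun s => ENNReal.ofReal (p s) * gE g (supS v R M (R+ε) s)) (ENNReal.ofReal A)
      (R - ε) r (by linarith) (by linarith) ?_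
    · have hr' : R - ε ∈ Ico 0 R := ⟨by linarith, by linarith⟩
      have h3 := hc _ hr'
      unfold PhiOp at h3 ⊢
      calc _ ≤ _ := add_le_add_right hk _
        _ = ENNReal.ofReal (u (R - ε)) + ENNReal.ofReal r * ENNReal.ofReal A * ENNReal.ofReal (r - (R - ε)) := by
          rw [← add_assoc, h3]
        _ ≤ _ := by
          gcongr
          · exact hMu _ hr'
          · push Not at h1
            rw [← ENNReal.ofReal_mul (by linarith), ← ENNReal.ofReal_mul (mul_nonneg (by linarith) hA0)]
            apply ENNReal.ofReal_le_ofReal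
            refine le_trans ?_ hεA
            have : 0 ≤ R + 1 := by linarith
            gcongr <;> linarith
    · intro s hs
      have h4 : supS v R M (R+ε) s ≤ ENNReal.ofReal (M+1) := by
        refine (supS_mono hR hmv hMv (hs.2.trans h2)).trans ?_
        have : ¬ (R + ε < R) := by linarith
        simp [supS, this]
      have h5 := gE_mono hgm h4
      rw [gE_ofReal g (by linarith)] at h5
      calc _ ≤ ENNReal.ofReal (p s) * ENNReal.ofReal (g (M+1)) := by gcongr
        _ = ENNReal.ofReal (p s * g (M+1)) := (ENNReal.ofReal_mul (hp0 s hs.1.le)).symm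
        _ ≤ _ := ENNReal.ofReal_le_ofReal (hA s ⟨hs.1.le, by linarith [hs.2]⟩)
  · simp [supS, h1, h2]

lemma main_aux (j : ℕ) (f g p q : ℝ → ℝ)
    (hF1 : hypF1 f g)
    (hp : ContinuousOn p (Ici 0)) (hq : ContinuousOn q (Ici 0))
    (hp0 : ∀ s : ℝ, 0 ≤ s → 0 ≤ p s) (hq0 : ∀ s : ℝ, 0 ≤ s → 0 ≤ q s)
    (a b : ℝ) (ha : 0 < a) (hb : 0 < b) (R : ℝ) (hR : 0 < R)
    (u v : ℝ → ℝ) (hsol : IsRadODESol (j+2) p q f g a b R u v)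
    (hmax : ∀ T, R < T → ¬ ∃ u v, IsRadODESol (j+2) p q f g a b T u v) :
    Tendsto u (𝓝[<] R) atTop ∧ Tendsto v (𝓝[<] R) atTop := by
  have hF1' := hF1
  obtain ⟨hfc, hgc, -, -, hfm, hgm, hf0, hg0, hfp, hgp⟩ := hF1'
  have hf0 : ∀ s, 0 ≤ s → 0 ≤ f s := fun s hs => by
    rw [← hf0]; exact hfm self_mem_Ici hs hs
  have hg0 : ∀ s, 0 ≤ s → 0 ≤ g s := fun s hs => by
    rw [← hg0]; exact hgm self_mem_Ici hs hs
  obtain ⟨hu, hv, hpos, hua, hvb, -, -, hode⟩ := hsol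
  have hu0 : ∀ r ∈ Ico 0 R, 0 < u r := fun r hr => (hpos r hr).1
  have hv0 : ∀ r ∈ Ico 0 R, 0 < v r := fun r hr => (hpos r hr).2
  have ru := old_rep j hgc hg0 hp hp0 a R ha hu hv.continuousOn (fun r hr => (hv0 r hr).le) hua
    (fun r hr => (hode r hr).1)
  have rv := old_rep j hfc hf0 hq hq0 b R hb hv hu.continuousOn (fun r hr => (hu0 r hr).le) hvb
    (fun r hr => (hode r hr).2)
  have mu := old_mono hu0 ru
  have mv := old_mono hv0 rv
  by_contra hcon
  have hbd : ∃ M, (∀ r ∈ Ico 0 R, u r ≤ M) ∧ ∀ r ∈ Ico 0 R, v r ≤ M := by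
    have : (∃ M, ∀ r ∈ Ico 0 R, u r ≤ M) ∧ (∃ M, ∀ r ∈ Ico 0 R, v r ≤ M) := by
      by_cases h : Tendsto u (𝓝[<] R) atTop
      · have h2 : ¬ Tendsto v (𝓝[<] R) atTop := fun h' => hcon ⟨h, h'⟩
        obtain ⟨M, hM⟩ := bdd_of_not mv h2
        exact ⟨old_bdd hgm hp hv0 ru hM, M, hM⟩
      · obtain ⟨M, hM⟩ := bdd_of_not mu h
        exact ⟨⟨M, hM⟩, old_bdd hfm hq hu0 rv hM⟩
    obtain ⟨⟨M1, h1⟩, M2, h2⟩ := this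
    exact ⟨max M1 M2, fun r hr => (h1 r hr).trans (le_max_left _ _),
      fun r hr => (h2 r hr).trans (le_max_right _ _)⟩
  obtain ⟨M, hMu, hMv⟩ := hbd
  have h0R : (0:ℝ) ∈ Ico 0 R := ⟨le_rfl, hR⟩
  have hM : 0 ≤ M := (hu0 0 h0R).le.trans (hMu 0 h0R)
  obtain ⟨P, hP⟩ := (isCompact_Icc (a := (0:ℝ)) (b := R+1)).bddAbove_image (hp.mono Icc_subset_Ici_self)
  obtain ⟨Q, hQ⟩ := (isCompact_Icc (a := (0:ℝ)) (b := R+1)).bddAbove_image (hq.mono Icc_subset_Ici_self)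
  set A := max 0 (max (P * g (M+1)) (Q * f (M+1))) with hAdef
  have hA0 : 0 ≤ A := le_max_left _ _
  have hA1 : ∀ s ∈ Icc 0 (R+1), p s * g (M+1) ≤ A := fun s hs =>
    (mul_le_mul_of_nonneg_right (hP ⟨s, hs, rfl⟩) (hg0 _ (by linarith))).trans
      ((le_max_left _ _).trans (le_max_right _ _))
  have hA2 : ∀ s ∈ Icc 0 (R+1), q s * f (M+1) ≤ A := fun s hs =>
    (mul_le_mul_of_nonneg_right (hQ ⟨s, hs, rfl⟩) (hf0 _ (by linarith))).trans
      ((le_max_right _ _).trans (le_max_right _ _))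
  obtain ⟨ε, hε, hε1, hεR, hεA⟩ : ∃ ε : ℝ, 0 < ε ∧ ε ≤ 1 ∧ ε ≤ R ∧ (R+1) * A * (2 * ε) ≤ 1 := by
    have hd : 0 < 2 * (R+1) * (A+1) := by positivity
    refine ⟨min (min 1 R) (1 / (2 * (R+1) * (A+1))), by positivity,
      (min_le_left _ _).trans (min_le_left _ _), (min_le_left _ _).trans (min_le_right _ _), ?_⟩
    have h1 := min_le_right (min 1 R) (1 / (2 * (R+1) * (A+1)))
    have h2 : (0:ℝ) < min (min 1 R) (1 / (2 * (R+1) * (A+1))) := by positivity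
    rw [le_div_iff₀ hd] at h1
    nlinarith [mul_pos h2 (by linarith : 0 < R + 1)]
  have hnl : ¬ (R + ε < R) := by linarith
  exact hmax (R + ε) (by linarith) (sol_of_super j f g p q hF1 hp hq hp0 hq0 a b ha hb (R+ε) (by linarith)
    (supS u R M (R+ε)) (supS v R M (R+ε)) (supS_mono hR mu hMu) (supS_mono hR mv hMv)
    (supS_super hR hgm hp0 hv0 mv ru hMv hMu hM hε hε1 hεR hA0 hA1 hεA)
    (supS_super hR hfm hq0 hu0 mu rv hMu hMv hM hε hε1 hεR hA0 hA2 hεA)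
    (by simp [supS, hnl]) (by simp [supS, hnl]))

/-- Lemma: Alternative.  If the maximal existence radius
`R_{a,b} = sSup (odeSolSet …)` is finite (the set of existence radii being
nonempty and bounded above), then any maximal solution blows up at `R_{a,b}`. -/
theorem blow_up_at_finite_maximal_radius
    (n : ℕ) (hn : 3 ≤ n) (f g p q : ℝ → ℝ)
    (hF1 : hypF1 f g)
    (hp : ContinuousOn p (Ici 0)) (hq : ContinuousOn q (Ici 0))
    (hp0 : ∀ s : ℝ, 0 ≤ s → 0 ≤ p s) (hq0 : ∀ s : ℝ, 0 ≤ s → 0 ≤ q s)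
    (a b : ℝ) (ha : 0 < a) (hb : 0 < b)
    (hne : (odeSolSet n p q f g a b).Nonempty)
    (hbdd : BddAbove (odeSolSet n p q f g a b))
    (u v : ℝ → ℝ)
    (hsol : IsRadODESol n p q f g a b (sSup (odeSolSet n p q f g a b)) u v) :
    Tendsto u (𝓝[<] (sSup (odeSolSet n p q f g a b))) atTop ∧
    Tendsto v (𝓝[<] (sSup (odeSolSet n p q f g a b))) atTop := by
  obtain ⟨j, rfl⟩ : ∃ j, n = j + 2 := ⟨n - 2, by omega⟩
  have hR : 0 < sSup (odeSolSet (j+2) p q f g a b) := by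
    obtain ⟨ρ, hρ⟩ := hne
    exact hρ.1.trans_le (le_csSup hbdd hρ)
  refine main_aux j f g p q hF1 hp hq hp0 hq0 a b ha hb _ hR u v hsol ?_
  intro T hT hex
  exact absurd (le_csSup hbdd (show T ∈ odeSolSet (j+2) p q f g a b from ⟨hR.trans hT, hex⟩)) (not_le.2 hT)
end

section
/- Let (u,v) be a positive radial C² solution of the system on [0,ρ) with central values (a,b), a,b > 0. Then for every r ∈ (0,ρ): u''(r) + ((n−1)/r) u'(r) ≤ p(r) · g(f(u(r))) · g(b/f(a) + L_q) and v''(r) + ((n−1)/r) v'(r) ≤ q(r) · f(g(v(r))) · f(a/g(b) + L_p). -/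
open MeasureTheory Set Filter Topology

section helpers

noncomputable def auxI (m : ℕ) (W : ℝ → ℝ) (t : ℝ) : ℝ := ∫ s in (0:ℝ)..t, s ^ (m+2) * W s
noncomputable def auxG (m : ℕ) (W : ℝ → ℝ) (t : ℝ) : ℝ := (t ^ (m+2))⁻¹ * auxI m W t
noncomputable def auxK (m : ℕ) (W : ℝ → ℝ) (r : ℝ) : ℝ := ∫ t in (0:ℝ)..r, auxG m W t

variable {m : ℕ} {W : ℝ → ℝ}

lemma auxI_deriv (hW : Continuous W) (t : ℝ) : HasDerivAt (auxI m W) (t ^ (m+2) * W t) t := by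
  have hc : Continuous (fun s : ℝ => s ^ (m+2) * W s) := by fun_prop
  exact intervalIntegral.integral_hasDerivAt_right (hc.intervalIntegrable _ _)
    hc.stronglyMeasurable.stronglyMeasurableAtFilter hc.continuousAt

lemma auxG_deriv (hW : Continuous W) (t : ℝ) (ht : 0 < t) :
    HasDerivAt (auxG m W) (W t - ((m:ℝ)+2) / t * auxG m W t) t := by
  have h1 := (((hasDerivAt_id t).pow (m+2)).inv (by simp [ht.ne'])).mul (auxI_deriv (m := m) hW t)
  refine h1.congr_deriv ?_
  have := ht.ne'
  simp only [auxG, id, Pi.pow_apply, Pi.inv_apply]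
  have e : m + 2 - 1 = m + 1 := rfl
  rw [e]
  push_cast
  field_simp
  ring

lemma auxI_nonneg (hW0 : ∀ x, 0 ≤ W x) (t : ℝ) (ht : 0 ≤ t) : 0 ≤ auxI m W t := by
  apply intervalIntegral.integral_nonneg ht
  intro x hx
  exact mul_nonneg (pow_nonneg hx.1 _) (hW0 x)

lemma auxG_nonneg (hW0 : ∀ x, 0 ≤ W x) (t : ℝ) (ht : 0 ≤ t) : 0 ≤ auxG m W t :=
  mul_nonneg (inv_nonneg.2 (pow_nonneg ht _)) (auxI_nonneg hW0 t ht)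

lemma auxG_le (hW : Continuous W) (hW0 : ∀ x, 0 ≤ W x) (t : ℝ) (ht : 0 ≤ t) :
    auxG m W t ≤ ∫ s in (0:ℝ)..t, W s := by
  rcases ht.eq_or_lt with rfl | ht'
  · simp [auxG]
  have h : auxI m W t ≤ t ^ (m+2) * ∫ s in (0:ℝ)..t, W s := by
    rw [← intervalIntegral.integral_const_mul]
    have hc : Continuous (fun s : ℝ => s ^ (m+2) * W s) := by fun_prop
    have hc' : Continuous (fun s : ℝ => t ^ (m+2) * W s) := by fun_prop
    apply intervalIntegral.integral_mono_on ht (hc.intervalIntegrable _ _)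
      (hc'.intervalIntegrable _ _)
    intro x hx
    exact mul_le_mul_of_nonneg_right (pow_le_pow_left₀ hx.1 hx.2 _) (hW0 x)
  rw [auxG, inv_mul_le_iff₀ (by positivity)]
  exact h

lemma auxG_cont (hW : Continuous W) (hW0 : ∀ x, 0 ≤ W x) :
    ContinuousOn (auxG m W) (Ici 0) := by
  intro t ht
  rcases (mem_Ici.1 ht).eq_or_lt with rfl | ht'
  · have h0 : auxG m W 0 = 0 := by simp [auxG]
    have hc : Continuous (fun t : ℝ => ∫ s in (0:ℝ)..t, W s) :=
      intervalIntegral.continuous_primitive (fun a b => hW.intervalIntegrable _ _) 0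
    have hl : Tendsto (fun t : ℝ => ∫ s in (0:ℝ)..t, W s) (𝓝[Ici 0] 0) (𝓝 0) := by
      have := hc.continuousWithinAt (s := Ici 0) (x := 0)
      simpa [ContinuousWithinAt] using this
    rw [ContinuousWithinAt, h0]
    refine tendsto_of_tendsto_of_tendsto_of_le_of_le' tendsto_const_nhds hl ?_ ?_
    · filter_upwards [self_mem_nhdsWithin] with x hx using auxG_nonneg hW0 x hx
    · filter_upwards [self_mem_nhdsWithin] with x hx using auxG_le hW hW0 x hx
  · exact (auxG_deriv hW t ht').continuousAt.continuousWithinAt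

lemma auxK_eq (r : ℝ) (hr : 0 ≤ r) :
    auxK m W r = ∫ t in (0:ℝ)..r, auxG m W (max t 0) := by
  apply intervalIntegral.integral_congr
  intro x hx
  rw [uIcc_of_le hr] at hx
  simp [max_eq_left hx.1]

lemma auxGm_cont (hW : Continuous W) (hW0 : ∀ x, 0 ≤ W x) :
    Continuous (fun t => auxG m W (max t 0)) :=
  (auxG_cont hW hW0).comp_continuous (by fun_prop) (fun x => mem_Ici.2 (le_max_right x 0))

lemma auxK_cont (hW : Continuous W) (hW0 : ∀ x, 0 ≤ W x) :
    ContinuousOn (auxK m W) (Ici 0) := by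
  have hc : Continuous (fun r : ℝ => ∫ t in (0:ℝ)..r, auxG m W (max t 0)) :=
    intervalIntegral.continuous_primitive
      (fun a b => (auxGm_cont hW hW0).intervalIntegrable _ _) 0
  exact hc.continuousOn.congr (fun r hr => auxK_eq r hr)

lemma auxK_deriv (hW : Continuous W) (hW0 : ∀ x, 0 ≤ W x) (t : ℝ) (ht : 0 < t) :
    HasDerivAt (auxK m W) (auxG m W t) t := by
  have hc := auxGm_cont (m := m) hW hW0
  have h := intervalIntegral.integral_hasDerivAt_right (hc.intervalIntegrable 0 t)
    hc.stronglyMeasurable.stronglyMeasurableAtFilter hc.continuousAt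
  simp only [max_eq_left ht.le] at h
  refine h.congr_of_eventuallyEq ?_
  filter_upwards [lt_mem_nhds ht] with x hx using auxK_eq x hx.le

lemma auxK_mono (hW : Continuous W) (hW0 : ∀ x, 0 ≤ W x) :
    MonotoneOn (auxK m W) (Ici 0) := by
  apply monotoneOn_of_deriv_nonneg (convex_Ici 0) (auxK_cont hW hW0)
  · rw [interior_Ici]
    intro x hx
    exact (auxK_deriv hW hW0 x hx).differentiableAt.differentiableWithinAt
  · rw [interior_Ici]
    intro x hx
    rw [(auxK_deriv hW hW0 x hx).deriv]
    exact auxG_nonneg hW0 x (le_of_lt hx)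

lemma auxK_le (hW : Continuous W) (hW0 : ∀ x, 0 ≤ W x) (r : ℝ) (hr : 0 ≤ r) :
    auxK m W r ≤ (1 / ((m:ℝ)+1)) * ∫ s in (0:ℝ)..r, s * W s := by
  have hc : Continuous (fun s : ℝ => s * W s) := by fun_prop
  let D : ℝ → ℝ := fun t => (1 / ((m:ℝ)+1)) * (∫ s in (0:ℝ)..t, s * W s)
    - (1 / ((m:ℝ)+1)) * (t * auxG m W t) - auxK m W t
  have hder : ∀ x, 0 < x → HasDerivAt D 0 x := by
    intro x hx
    have h1 : HasDerivAt (fun t => ∫ s in (0:ℝ)..t, s * W s) (x * W x) x :=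
      intervalIntegral.integral_hasDerivAt_right (hc.intervalIntegrable _ _)
        hc.stronglyMeasurable.stronglyMeasurableAtFilter hc.continuousAt
    have h2 := ((hasDerivAt_id x).mul (auxG_deriv (m := m) hW x hx)).const_mul (1 / ((m:ℝ)+1))
    have h := ((h1.const_mul (1 / ((m:ℝ)+1))).sub h2).sub (auxK_deriv (m := m) hW hW0 x hx)
    refine h.congr_deriv ?_
    have : (m:ℝ) + 1 ≠ 0 := by positivity
    have := hx.ne'
    simp only [id]
    field_simp
    ring
  have hDc : ContinuousOn D (Ici 0) := by
    have hcc : Continuous (fun r : ℝ => ∫ t in (0:ℝ)..r, t * W t) :=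
      intervalIntegral.continuous_primitive (fun a b => hc.intervalIntegrable _ _) 0
    exact ((continuousOn_const.mul hcc.continuousOn).sub
      (continuousOn_const.mul (continuousOn_id.mul (auxG_cont hW hW0)))).sub (auxK_cont hW hW0)
  have hmono : MonotoneOn D (Ici 0) := by
    apply monotoneOn_of_deriv_nonneg (convex_Ici 0) hDc
    · rw [interior_Ici]
      intro x hx
      exact (hder x hx).differentiableAt.differentiableWithinAt
    · rw [interior_Ici]
      intro x hx
      rw [(hder x hx).deriv]
  have h0 : D 0 = 0 := by simp [D, auxK]
  have h1 : D 0 ≤ D r := hmono self_mem_Ici hr hr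
  rw [h0] at h1
  have h2 : 0 ≤ (1 / ((m:ℝ)+1)) * (r * auxG m W r) :=
    mul_nonneg (by positivity) (mul_nonneg hr (auxG_nonneg hW0 r hr))
  simp only [D] at h1
  linarith

/-- Everything needed for one component. -/
lemma core (n : ℕ) (hn : 3 ≤ n) (w h φ y : ℝ → ℝ) (c ρ : ℝ)
    (hw : ContinuousOn w (Ici 0)) (hw0 : ∀ s, 0 ≤ s → 0 ≤ w s)
    (hi : IntegrableOn (fun s : ℝ => s * w s) (Ioi 0))
    (hh : ContinuousOn h (Ici 0)) (hh0 : ∀ s, 0 < s → 0 < h s)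
    (hφ : ContinuousOn φ (Ico 0 ρ)) (hφ0 : ∀ r ∈ Ico 0 ρ, 0 < φ r)
    (hy : ∀ r ∈ Ico 0 ρ, y r = c + radK n w h φ r) (r : ℝ) (hr : r ∈ Ioo 0 ρ) :
    (deriv (deriv y) r + ((n : ℝ) - 1) / r * deriv y r = w r * h (φ r)) ∧
    (∀ s ∈ Icc 0 r, ∀ t ∈ Icc 0 r, s ≤ t → y s ≤ y t) ∧
    ((∀ s ∈ Icc 0 r, h (φ s) ≤ h (φ r)) → y r ≤ c + h (φ r) * Lcoef n w) := by
  obtain ⟨m, rfl⟩ : ∃ m, n = m + 3 := ⟨n - 3, by omega⟩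
  obtain ⟨R, hrR, hRρ⟩ := exists_between hr.2
  have hr0 := hr.1
  have hR0 : 0 ≤ R := (hr0.trans hrR).le
  let W : ℝ → ℝ := fun x => w (max 0 (min R x)) * h (φ (max 0 (min R x)))
  have hmem : ∀ x : ℝ, max 0 (min R x) ∈ Ico 0 ρ := fun x =>
    ⟨le_max_left _ _, lt_of_le_of_lt (max_le hR0 (min_le_left _ _)) hRρ⟩
  have hcl : Continuous (fun x : ℝ => max 0 (min R x)) := by fun_prop
  have hW : Continuous W := by
    refine (hw.comp_continuous hcl (fun x => (hmem x).1)).mul ?_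
    exact hh.comp_continuous (hφ.comp_continuous hcl hmem) (fun x => (hφ0 _ (hmem x)).le)
  have hW0 : ∀ x, 0 ≤ W x := fun x =>
    mul_nonneg (hw0 _ (hmem x).1) (hh0 _ (hφ0 _ (hmem x))).le
  have hWeq : ∀ x ∈ Icc 0 R, W x = w x * h (φ x) := by
    intro x hx
    simp only [W, min_eq_right hx.2, max_eq_right hx.1]
  have hK : ∀ x ∈ Icc 0 R, radK (m+3) w h φ x = auxK m W x := by
    intro x hx
    apply intervalIntegral.integral_congr
    intro t ht
    rw [uIcc_of_le hx.1] at ht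
    have e1 : t ^ (1 - ((m+3 : ℕ) : ℤ)) = (t ^ (m+2))⁻¹ := by
      rw [← zpow_natCast, ← zpow_neg]
      congr 1
    simp only [auxG, auxI]
    rw [e1]
    congr 1
    apply intervalIntegral.integral_congr
    intro s hs
    rw [uIcc_of_le ht.1] at hs
    have e2 : s ^ (((m+3 : ℕ) : ℤ) - 1) = s ^ (m+2) := by
      rw [← zpow_natCast]
      congr 1
      push_cast
      ring
    simp only
    rw [e2, hWeq s ⟨hs.1, hs.2.trans (ht.2.trans hx.2)⟩, mul_assoc]
  have hyK : ∀ x ∈ Icc 0 R, y x = c + auxK m W x := by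
    intro x hx
    rw [hy x ⟨hx.1, hx.2.trans_lt hRρ⟩, hK x hx]
  have hd1 : ∀ x ∈ Ioo 0 R, HasDerivAt y (auxG m W x) x := by
    intro x hx
    refine ((auxK_deriv hW hW0 x hx.1).const_add c).congr_of_eventuallyEq ?_
    filter_upwards [Ioo_mem_nhds hx.1 hx.2] with z hz using hyK z ⟨hz.1.le, hz.2.le⟩
  have hd2 : HasDerivAt (deriv y) (W r - ((m:ℝ)+2) / r * auxG m W r) r := by
    refine (auxG_deriv hW r hr0).congr_of_eventuallyEq ?_
    filter_upwards [Ioo_mem_nhds hr0 hrR] with z hz using (hd1 z hz).deriv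
  have hrm : r ∈ Icc 0 R := ⟨hr0.le, hrR.le⟩
  refine ⟨?_, ?_, ?_⟩
  · rw [hd2.deriv, (hd1 r ⟨hr0, hrR⟩).deriv, hWeq r hrm]
    push_cast
    ring
  · intro s hs t ht hst
    rw [hyK s ⟨hs.1, hs.2.trans hrR.le⟩, hyK t ⟨ht.1, ht.2.trans hrR.le⟩]
    linarith [auxK_mono (m := m) hW hW0 (mem_Ici.2 hs.1) (mem_Ici.2 ht.1) hst]
  · intro hmon
    rw [hyK r hrm]
    have h1 := auxK_le (m := m) hW hW0 r hr0.le
    have hH : 0 ≤ h (φ r) := (hh0 _ (hφ0 _ ⟨hr0.le, hr.2⟩)).le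
    have hii : IntervalIntegrable (fun s : ℝ => s * w s) volume 0 r := by
      rw [intervalIntegrable_iff_integrableOn_Ioc_of_le hr0.le]
      exact hi.mono_set Ioc_subset_Ioi_self
    have h2 : ∫ s in (0:ℝ)..r, s * W s ≤ h (φ r) * ∫ s in (0:ℝ)..r, s * w s := by
      rw [← intervalIntegral.integral_const_mul]
      have hc : Continuous (fun s : ℝ => s * W s) := by fun_prop
      apply intervalIntegral.integral_mono_on hr0.le (hc.intervalIntegrable _ _)
        (hii.const_mul _)
      intro x hx
      rw [hWeq x ⟨hx.1, hx.2.trans hrR.le⟩]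
      have := mul_le_mul_of_nonneg_left (hmon x hx) (mul_nonneg hx.1 (hw0 x hx.1))
      linarith
    have h3 : ∫ s in (0:ℝ)..r, s * w s ≤ ∫ s in Ioi (0:ℝ), s * w s := by
      rw [intervalIntegral.integral_of_le hr0.le]
      apply setIntegral_mono_set hi
      · filter_upwards [ae_restrict_mem measurableSet_Ioi] with x hx
        exact mul_nonneg (le_of_lt hx) (hw0 x (le_of_lt hx))
      · exact Ioc_subset_Ioi_self.eventuallyLE
    have h4 := h2.trans (mul_le_mul_of_nonneg_left h3 hH)
    have hm : 0 ≤ 1 / ((m:ℝ)+1) := by positivity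
    have h5 := h1.trans (mul_le_mul_of_nonneg_left h4 hm)
    have e : Lcoef (m+3) w = (1 / ((m:ℝ)+1)) * ∫ s in Ioi (0:ℝ), s * w s := by
      unfold Lcoef
      congr 2
      push_cast
      ring
    rw [e]
    linarith

lemma Lcoef_nonneg (n : ℕ) (hn : 3 ≤ n) (w : ℝ → ℝ) (hw0 : ∀ s, 0 ≤ s → 0 ≤ w s) :
    0 ≤ Lcoef n w := by
  have : (3:ℝ) ≤ n := by exact_mod_cast hn
  apply mul_nonneg
  · apply div_nonneg zero_le_one; linarith
  · apply setIntegral_nonneg measurableSet_Ioi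
    intro x hx
    exact mul_nonneg (le_of_lt hx) (hw0 x (le_of_lt hx))

lemma final_step (g : ℝ → ℝ) (hgm : MonotoneOn g (Ici 0))
    (hg2 : ∀ l : ℝ, 0 ≤ l → ∀ t : ℝ, 0 ≤ t → g (l * t) ≤ g l * g t)
    (P b F F0 L V : ℝ) (hP : 0 ≤ P) (hb : 0 < b) (hF0 : 0 < F0) (hF : F0 ≤ F) (hL : 0 ≤ L)
    (hV : 0 ≤ V) (hVle : V ≤ b + F * L) :
    P * g V ≤ P * g F * g (b / F0 + L) := by
  have hFp : 0 < F := hF0.trans_le hF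
  have h1 : V ≤ F * (b / F0 + L) := by
    have : b ≤ F * (b / F0) := by
      rw [mul_div_assoc', le_div_iff₀ hF0]
      nlinarith
    linarith
  have hn : 0 ≤ b / F0 + L := by positivity
  have h2 := (hgm (mem_Ici.2 hV) (mem_Ici.2 (mul_nonneg hFp.le hn)) h1).trans (hg2 F hFp.le _ hn)
  rw [mul_assoc]
  exact mul_le_mul_of_nonneg_left h2 hP

end helpers

/-- Lemma: Forcing inequality, first part. -/
theorem forcing_inequality
    (n : ℕ) (hn : 3 ≤ n) (f g p q : ℝ → ℝ)
    (hF1 : hypF1 f g) (hF2 : hypF2 f g) (hPQ : hypPQ p q)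
    (a b ρ : ℝ) (ha : 0 < a) (hb : 0 < b)
    (u v : ℝ → ℝ) (hsol : IsRadSol n p q f g a b ρ u v) :
    ∀ r ∈ Ioo (0:ℝ) ρ,
      deriv (deriv u) r + ((n : ℝ) - 1) / r * deriv u r ≤
        p r * g (f (u r)) * g (b / f a + Lcoef n q) ∧
      deriv (deriv v) r + ((n : ℝ) - 1) / r * deriv v r ≤
        q r * f (g (v r)) * f (a / g b + Lcoef n p) := by
  obtain ⟨hfc, hgc, -, -, hfm, hgm, -, -, hf0, hg0⟩ := hF1
  obtain ⟨hpc, hqc, hp0, hq0, -, hpi, hqi, -⟩ := hPQ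
  obtain ⟨hu, hv, hpos, hue, hve⟩ := hsol
  intro r hr
  have hr0 : r ∈ Ico 0 ρ := ⟨hr.1.le, hr.2⟩
  have hρ : (0:ℝ) ∈ Ico 0 ρ := ⟨le_rfl, hr.1.trans hr.2⟩
  obtain ⟨hu1, hu2, hu3⟩ := core n hn p g v u a ρ hpc hp0 hpi hgc hg0 hv.continuousOn
    (fun r hr => (hpos r hr).2) hue r hr
  obtain ⟨hv1, hv2, hv3⟩ := core n hn q f u v b ρ hqc hq0 hqi hfc hf0 hu.continuousOn
    (fun r hr => (hpos r hr).1) hve r hr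
  have hu0 : u 0 = a := by rw [hue 0 hρ]; simp [radK]
  have hv0 : v 0 = b := by rw [hve 0 hρ]; simp [radK]
  have hrr : r ∈ Icc 0 r := ⟨hr.1.le, le_rfl⟩
  have h0r : (0:ℝ) ∈ Icc 0 r := ⟨le_rfl, hr.1.le⟩
  have hIco : ∀ s ∈ Icc 0 r, s ∈ Ico 0 ρ := fun s hs => ⟨hs.1, hs.2.trans_lt hr.2⟩
  have hfu : ∀ s ∈ Icc 0 r, f (u s) ≤ f (u r) := fun s hs =>
    hfm (hpos s (hIco s hs)).1.le (hpos r hr0).1.le (hu2 s hs r hrr hs.2)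
  have hgv : ∀ s ∈ Icc 0 r, g (v s) ≤ g (v r) := fun s hs =>
    hgm (hpos s (hIco s hs)).2.le (hpos r hr0).2.le (hv2 s hs r hrr hs.2)
  rw [hu1, hv1]
  constructor
  · exact final_step g hgm hF2.2 _ b _ _ _ _ (hp0 r hr.1.le) hb (hf0 a ha)
      (hu0 ▸ hfu 0 h0r) (Lcoef_nonneg n hn q hq0) (hpos r hr0).2.le (hv3 hfu)
  · exact final_step f hfm hF2.1 _ a _ _ _ _ (hq0 r hr.1.le) ha (hg0 b hb)
      (hv0 ▸ hgv 0 h0r) (Lcoef_nonneg n hn p hp0) (hpos r hr0).1.le (hu3 hgv)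
end

section
/- Let (u,v) be a positive radial C² solution of the system on [0,ρ) with central values (a,b), a,b > 0. Then for every r ∈ (0,ρ) the compositions Φ∘u and Ψ∘v satisfy (Φ∘u)''(r) + ((n−1)/r)(Φ∘u)'(r) ≥ −p(r) · g(b/f(a) + L_q) and (Ψ∘v)''(r) + ((n−1)/r)(Ψ∘v)'(r) ≥ −q(r) · f(a/g(b) + L_p). -/
open MeasureTheory Set Filter Topology

lemma koA_cont (m : ℕ) (k : ℝ → ℝ) (hk : Continuous k) :
    Continuous (fun t : ℝ => (t ^ m)⁻¹ * ∫ s in (0:ℝ)..t, s ^ m * k s) := by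
  have hA : ∀ t : ℝ, HasDerivAt (fun t : ℝ => ∫ s in (0:ℝ)..t, s ^ m * k s) (t ^ m * k t) t := by
    intro t
    have hc : Continuous (fun s : ℝ => s ^ m * k s) := by fun_prop
    exact intervalIntegral.integral_hasDerivAt_right (hc.intervalIntegrable _ _)
      (hc.stronglyMeasurableAtFilter _ _) hc.continuousAt
  rw [continuous_iff_continuousAt]
  intro t
  by_cases ht : t = 0
  · subst ht
    obtain ⟨M, hM⟩ := (isCompact_Icc (a := (-1:ℝ)) (b := 1)).exists_bound_of_continuousOn
      hk.continuousOn
    have hM0 : 0 ≤ M := le_trans (norm_nonneg _) (hM 0 (by simp))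
    have hb : ∀ᶠ t in 𝓝 (0:ℝ),
        ‖(t ^ m)⁻¹ * ∫ s in (0:ℝ)..t, s ^ m * k s‖ ≤ M * |t| := by
      filter_upwards [Icc_mem_nhds (show (-1:ℝ) < 0 by norm_num) (show (0:ℝ) < 1 by norm_num)]
        with t ht
      have h1 : ‖∫ s in (0:ℝ)..t, s ^ m * k s‖ ≤ (|t| ^ m * M) * |t - 0| := by
        apply intervalIntegral.norm_integral_le_of_norm_le_const
        intro s hs
        have hs1 : |s| ≤ |t| := by
          rcases le_total 0 t with h | h
          · rw [uIoc_of_le h] at hs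
            rw [abs_of_pos hs.1, abs_of_nonneg h]; exact hs.2
          · rw [uIoc_of_ge h] at hs
            rw [abs_of_nonpos hs.2, abs_of_nonpos h]; linarith [hs.1]
        have ht1 : |t| ≤ 1 := abs_le.2 ht
        have hs2 := hM s (abs_le.1 (hs1.trans ht1))
        rw [norm_mul, norm_pow, Real.norm_eq_abs]
        gcongr
      rw [sub_zero] at h1
      by_cases ht0 : t = 0
      · subst ht0; simp
      · have hp : 0 < |t| ^ m := by positivity
        rw [norm_mul, norm_inv, norm_pow, Real.norm_eq_abs]
        calc (|t| ^ m)⁻¹ * ‖∫ s in (0:ℝ)..t, s ^ m * k s‖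
            ≤ (|t| ^ m)⁻¹ * ((|t| ^ m * M) * |t|) := by gcongr
          _ = M * |t| := by field_simp
    have hl : Tendsto (fun t : ℝ => M * |t|) (𝓝 0) (𝓝 0) := by
      have : Continuous (fun t : ℝ => M * |t|) := by fun_prop
      simpa using this.tendsto 0
    have := squeeze_zero_norm' hb hl
    simpa [ContinuousAt] using this
  · exact ((continuousAt_id.pow m).inv₀ (pow_ne_zero _ ht)).mul (hA t).continuousAt

lemma koA_deriv (m : ℕ) (k : ℝ → ℝ) (hk : Continuous k) (r : ℝ) (hr : 0 < r) :
    HasDerivAt (fun t : ℝ => (t ^ m)⁻¹ * ∫ s in (0:ℝ)..t, s ^ m * k s)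
      (k r - (m : ℝ) / r * ((r ^ m)⁻¹ * ∫ s in (0:ℝ)..r, s ^ m * k s)) r := by
  have hc : Continuous (fun s : ℝ => s ^ m * k s) := by fun_prop
  have hA := intervalIntegral.integral_hasDerivAt_right (hc.intervalIntegrable 0 r)
      (hc.stronglyMeasurableAtFilter _ _) hc.continuousAt
  have hp := (hasDerivAt_pow m r).inv (pow_ne_zero m hr.ne')
  have h := hp.mul hA
  refine h.congr_deriv ?_
  rcases m with _ | m
  · simp
  · simp only [Nat.add_sub_cancel]
    simp only [Pi.inv_apply]
    field_simp
    ring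

/-- The kernel estimate. -/
lemma koK_eq (m : ℕ) (hm : 2 ≤ m) (k : ℝ → ℝ) (hk : Continuous k) (h0 : ∀ s, 0 ≤ s → 0 ≤ k s)
    (r : ℝ) (hr : 0 ≤ r) :
    ∫ t in (0:ℝ)..r, (t ^ m)⁻¹ * ∫ s in (0:ℝ)..t, s ^ m * k s
      ≤ (1 / ((m : ℝ) - 1)) * ∫ s in (0:ℝ)..r, s * k s := by
  have hm1 : (0:ℝ) < (m:ℝ) - 1 := by
    have : (2:ℝ) ≤ m := by exact_mod_cast hm
    linarith
  set G : ℝ → ℝ := fun t : ℝ => (t ^ m)⁻¹ * ∫ s in (0:ℝ)..t, s ^ m * k s with hG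
  have hGc : Continuous G := koA_cont m k hk
  have hsk : Continuous (fun s : ℝ => s * k s) := by fun_prop
  have dK : ∀ x, HasDerivAt (fun r => ∫ t in (0:ℝ)..r, G t) (G x) x := fun x =>
    intervalIntegral.integral_hasDerivAt_right (hGc.intervalIntegrable _ _)
      (hGc.stronglyMeasurableAtFilter _ _) hGc.continuousAt
  have dS : ∀ x, HasDerivAt (fun r => ∫ s in (0:ℝ)..r, s * k s) (x * k x) x := fun x =>
    intervalIntegral.integral_hasDerivAt_right (hsk.intervalIntegrable _ _)
      (hsk.stronglyMeasurableAtFilter _ _) hsk.continuousAt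
  let H : ℝ → ℝ := fun x => (1 / ((m : ℝ) - 1)) * (∫ s in (0:ℝ)..x, s * k s)
    - (∫ t in (0:ℝ)..x, G t) - (1 / ((m : ℝ) - 1)) * (x * G x)
  have hHc : Continuous H := by
    have c1 : Continuous (fun r => ∫ t in (0:ℝ)..r, G t) :=
      continuous_iff_continuousAt.2 fun x => (dK x).continuousAt
    have c2 : Continuous (fun r => ∫ s in (0:ℝ)..r, s * k s) :=
      continuous_iff_continuousAt.2 fun x => (dS x).continuousAt
    exact ((continuous_const.mul c2).sub c1).sub (continuous_const.mul (continuous_id.mul hGc))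
  have hHd : ∀ x ∈ Ioo (0:ℝ) r, HasDerivAt H 0 x := by
    intro x hx
    have h := (((dS x).const_mul (1 / ((m : ℝ) - 1))).sub (dK x)).sub
      (((hasDerivAt_id x).mul (koA_deriv m k hk x hx.1)).const_mul (1 / ((m : ℝ) - 1)))
    refine h.congr_deriv ?_
    change 1 / ((m : ℝ) - 1) * (x * k x) - G x
      - 1 / ((m : ℝ) - 1) * (1 * G x + x * (k x - (m : ℝ) / x * G x)) = 0
    have := hx.1
    field_simp
    ring
  have hmono : MonotoneOn H (Icc 0 r) := by
    apply monotoneOn_of_deriv_nonneg (convex_Icc 0 r) hHc.continuousOn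
    · rw [interior_Icc]; exact fun x hx => (hHd x hx).differentiableAt.differentiableWithinAt
    · rw [interior_Icc]; exact fun x hx => (hHd x hx).deriv.ge
  have hH := hmono (left_mem_Icc.2 hr) (right_mem_Icc.2 hr) hr
  have hH0 : H 0 = 0 := by simp [H]
  have hGn : 0 ≤ G r := by
    apply mul_nonneg (by positivity)
    apply intervalIntegral.integral_nonneg hr
    intro s hs
    exact mul_nonneg (pow_nonneg hs.1 _) (h0 s hs.1)
  have : 0 ≤ (1 / ((m : ℝ) - 1)) * (r * G r) := by positivity
  simp only [H] at hH hH0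
  linarith

lemma ko_transform (h : ℝ → ℝ) (hpos : ∀ s, 0 < s → 0 < h s)
    (hdiff : DifferentiableOn ℝ h (Ioi 0)) (hmono : MonotoneOn h (Ioi 0))
    (hint : IntegrableOn (fun s : ℝ => 1 / h s) (Ioi 1))
    (U u1 : ℝ → ℝ) (u2 c C r : ℝ)
    (hU : ∀ᶠ x in 𝓝 r, HasDerivAt U (u1 x) x ∧ 0 < U x) (hu : HasDerivAt u1 u2 r)
    (hle : u2 + c * u1 r ≤ C * h (U r)) :
    -C ≤ deriv (deriv (fun x => ∫ s in Ioi (U x), 1 / h s)) r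
      + c * deriv (fun x => ∫ s in Ioi (U x), 1 / h s) r := by
  have hcont : ContinuousOn (fun s : ℝ => 1 / h s) (Ioi 0) :=
    continuousOn_const.div hdiff.continuousOn fun x hx => (hpos x hx).ne'
  have hintt : ∀ t, 0 < t → IntegrableOn (fun s : ℝ => 1 / h s) (Ioi t) := by
    intro t ht
    have h1 : IntegrableOn (fun s : ℝ => 1 / h s) (Icc t 1) :=
      (hcont.mono fun x hx => lt_of_lt_of_le ht hx.1).integrableOn_compact isCompact_Icc
    refine (h1.union hint).mono_set ?_
    intro x hx
    rcases le_or_gt x 1 with h | h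
    · exact Or.inl ⟨le_of_lt hx, h⟩
    · exact Or.inr h
  have hF : ∀ t, 0 < t → HasDerivAt (fun t => ∫ s in Ioi t, 1 / h s) (-(1 / h t)) t := by
    intro t ht
    have ht2 : 0 < t / 2 := by linarith
    have hii : IntervalIntegrable (fun s : ℝ => 1 / h s) volume (t/2) t := by
      apply ContinuousOn.intervalIntegrable_of_Icc (by linarith)
      exact hcont.mono fun x hx => lt_of_lt_of_le ht2 hx.1
    have d := intervalIntegral.integral_hasDerivAt_right hii
      (hcont.stronglyMeasurableAtFilter isOpen_Ioi t ht) (hcont.continuousAt (Ioi_mem_nhds ht))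
    have d2 := d.const_sub (∫ s in Ioi (t/2), 1 / h s)
    refine d2.congr_of_eventuallyEq ?_
    filter_upwards [Ioi_mem_nhds ht] with x hx
    have := intervalIntegral.integral_Ioi_sub_Ioi' (hintt _ ht2) (hintt x hx)
    linarith
  have hz : ∀ᶠ x in 𝓝 r, HasDerivAt (fun x => ∫ s in Ioi (U x), 1 / h s)
      (-(1 / h (U x)) * u1 x) x := by
    filter_upwards [hU] with x hx
    exact (hF _ hx.2).comp x hx.1
  have hUr := hU.self_of_nhds
  have hz1 : deriv (fun x => ∫ s in Ioi (U x), 1 / h s) =ᶠ[𝓝 r]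
      fun x => -(1 / h (U x)) * u1 x := by
    filter_upwards [hz] with x hx using hx.deriv
  rw [hz1.deriv_eq, hz1.self_of_nhds]
  have hhd := (hdiff.differentiableAt (Ioi_mem_nhds hUr.2)).hasDerivAt
  have hh0 : 0 ≤ deriv h (U r) := by
    rw [← derivWithin_of_mem_nhds (Ioi_mem_nhds hUr.2)]
    exact hmono.derivWithin_nonneg
  have hp := hpos _ hUr.2
  have d1 : HasDerivAt (fun x => h (U x)) (deriv h (U r) * u1 r) r := hhd.comp r hUr.1
  have d2 := ((d1.inv hp.ne').neg).mul hu
  have d3 : HasDerivAt (fun x => -(1 / h (U x)) * u1 x)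
      (deriv h (U r) * u1 r / h (U r) ^ 2 * u1 r - (1 / h (U r)) * u2) r := by
    refine (d2.congr_of_eventuallyEq ?_).congr_deriv ?_
    · exact Eventually.of_forall fun x => by simp
    · simp; ring
  rw [d3.deriv]
  have e1 : 0 ≤ deriv h (U r) * u1 r / h (U r) ^ 2 * u1 r := by
    have : deriv h (U r) * u1 r / h (U r) ^ 2 * u1 r
      = deriv h (U r) * (u1 r) ^ 2 / h (U r) ^ 2 := by ring
    rw [this]; positivity
  have e2 : (1 / h (U r)) * (u2 + c * u1 r) ≤ C := by
    rw [one_div, inv_mul_le_iff₀ hp, mul_comm]; linarith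
  have e3 : (1 / h (U r)) * (u2 + c * u1 r) = (1 / h (U r)) * u2 + c * ((1 / h (U r)) * u1 r) := by
    ring
  linarith

/-- Rewriting the radial kernel with a globally continuous density. -/
lemma radK_ext (n : ℕ) (hn : 3 ≤ n) (w h φ : ℝ → ℝ) (R : ℝ) (hR : 0 ≤ R)
    (hc : ContinuousOn (fun s => w s * h (φ s)) (Icc 0 R))
    (h0 : ∀ s ∈ Icc 0 R, 0 ≤ w s * h (φ s)) :
    ∃ k : ℝ → ℝ, Continuous k ∧ (∀ s, 0 ≤ k s) ∧ (∀ s ∈ Icc 0 R, k s = w s * h (φ s)) ∧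
      ∀ r ∈ Icc 0 R, radK n w h φ r =
        ∫ t in (0:ℝ)..r, (t ^ (n-1))⁻¹ * ∫ s in (0:ℝ)..t, s ^ (n-1) * k s := by
  refine ⟨IccExtend hR ((Icc 0 R).domRestrict fun s => w s * h (φ s)), ?_, ?_, ?_, ?_⟩
  · exact (continuousOn_iff_continuous_domRestrict.1 hc).Icc_extend'
  · intro s
    exact h0 _ (projIcc 0 R hR s).2
  · intro s hs
    rw [IccExtend_of_mem _ _ hs]; rfl
  · intro r hr
    unfold radK
    apply intervalIntegral.integral_congr
    intro t ht
    rw [uIcc_of_le hr.1] at ht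
    have e1 : (n:ℤ) - 1 = ((n-1 : ℕ) : ℤ) := by omega
    have e2 : 1 - (n:ℤ) = -((n-1 : ℕ) : ℤ) := by omega
    simp only [e1, e2, zpow_neg, zpow_natCast]
    congr 1
    apply intervalIntegral.integral_congr
    intro s hs
    rw [uIcc_of_le ht.1] at hs
    have hs' : s ∈ Icc 0 R := ⟨hs.1, hs.2.trans (ht.2.trans hr.2)⟩
    simp only [IccExtend_of_mem _ _ hs', mul_assoc]
    rfl

lemma ko_half
    (n : ℕ) (hn : 3 ≤ n) (f g p q : ℝ → ℝ)
    (fc : ContinuousOn f (Ici 0)) (gc : ContinuousOn g (Ici 0))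
    (fd : DifferentiableOn ℝ f (Ioi 0)) (gd : DifferentiableOn ℝ g (Ioi 0))
    (fm : MonotoneOn f (Ici 0)) (gm : MonotoneOn g (Ici 0))
    (fp : ∀ s : ℝ, 0 < s → 0 < f s) (gp : ∀ s : ℝ, 0 < s → 0 < g s)
    (gs : ∀ l : ℝ, 0 ≤ l → ∀ t : ℝ, 0 ≤ t → g (l * t) ≤ g l * g t)
    (pc : ContinuousOn p (Ici 0)) (qc : ContinuousOn q (Ici 0))
    (p0 : ∀ s : ℝ, 0 ≤ s → 0 ≤ p s) (q0 : ∀ s : ℝ, 0 ≤ s → 0 ≤ q s)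
    (qi : IntegrableOn (fun s : ℝ => s * q s) (Ioi 0))
    (hint1 : IntegrableOn (fun s : ℝ => 1 / g (f s)) (Ioi 1))
    (a b ρ : ℝ) (ha : 0 < a) (hb : 0 < b)
    (u v : ℝ → ℝ) (uc : ContinuousOn u (Ico 0 ρ)) (vc : ContinuousOn v (Ico 0 ρ))
    (hpos : ∀ r ∈ Ico (0:ℝ) ρ, 0 < u r ∧ 0 < v r)
    (hu : ∀ r ∈ Ico (0:ℝ) ρ, u r = a + radK n p g v r)
    (hv : ∀ r ∈ Ico (0:ℝ) ρ, v r = b + radK n q f u r) 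
    (r : ℝ) (hr : r ∈ Ioo (0:ℝ) ρ) :
      -(p r * g (b / f a + Lcoef n q)) ≤
        deriv (deriv (fun x => PhiKO f g (u x))) r +
          ((n : ℝ) - 1) / r * deriv (fun x => PhiKO f g (u x)) r := by
  obtain ⟨R, hrR, hRρ⟩ := exists_between hr.2
  have hR : 0 ≤ R := (hr.1.trans hrR).le
  have hsub : Icc 0 R ⊆ Ico 0 ρ := fun x hx => ⟨hx.1, hx.2.trans_lt hRρ⟩
  have hsub0 : Icc 0 R ⊆ Ici (0:ℝ) := fun x hx => hx.1
  obtain ⟨k, kc, k0, ke, kK⟩ := radK_ext n hn p g v R hR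
    ((pc.mono hsub0).mul (gc.comp (vc.mono hsub) fun x hx => (hpos x (hsub hx)).2.le))
    (fun s hs => mul_nonneg (p0 s hs.1) (gp _ (hpos s (hsub hs)).2).le)
  obtain ⟨l, lc, l0, le, lK⟩ := radK_ext n hn q f u R hR
    ((qc.mono hsub0).mul (fc.comp (uc.mono hsub) fun x hx => (hpos x (hsub hx)).1.le))
    (fun s hs => mul_nonneg (q0 s hs.1) (fp _ (hpos s (hsub hs)).1).le)
  set G : ℝ → ℝ := fun t : ℝ => (t ^ (n-1))⁻¹ * ∫ s in (0:ℝ)..t, s ^ (n-1) * k s with hG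
  have hGc : Continuous G := koA_cont (n-1) k kc
  have dK : ∀ x, HasDerivAt (fun r => ∫ t in (0:ℝ)..r, G t) (G x) x := fun x =>
    intervalIntegral.integral_hasDerivAt_right (hGc.intervalIntegrable _ _)
      (hGc.stronglyMeasurableAtFilter _ _) hGc.continuousAt
  have hGn : ∀ t, 0 ≤ t → 0 ≤ G t := by
    intro t ht
    apply mul_nonneg (by positivity)
    apply intervalIntegral.integral_nonneg ht
    intro s hs
    exact mul_nonneg (pow_nonneg hs.1 _) (k0 s)
  have hncast : ((n - 1 : ℕ) : ℝ) = (n:ℝ) - 1 := by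
    rw [Nat.cast_sub (by omega)]; simp
  have hrI : r ∈ Icc 0 R := ⟨hr.1.le, hrR.le⟩
  -- monotonicity of u
  have umono : ∀ s ∈ Icc 0 r, u s ≤ u r := by
    intro s hs
    have hsR : s ∈ Icc 0 R := ⟨hs.1, hs.2.trans hrR.le⟩
    rw [hu s (hsub hsR), hu r (hsub hrI), kK s hsR, kK r hrI]
    have := intervalIntegral.integral_interval_sub_left
      (hGc.intervalIntegrable (μ := volume) 0 r) (hGc.intervalIntegrable 0 s)
    have h2 : 0 ≤ ∫ t in s..r, G t :=
      intervalIntegral.integral_nonneg hs.2 fun t ht => hGn t (hs.1.trans ht.1)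
    linarith
  have ua : a ≤ u r := by
    have h0 : (0:ℝ) ∈ Icc 0 r := ⟨le_rfl, hr.1.le⟩
    have := umono 0 h0
    rw [hu 0 ⟨le_rfl, hr.1.trans hr.2⟩] at this
    simpa [radK] using this
  have upos := (hpos r (hsub hrI)).1
  have vpos := (hpos r (hsub hrI)).2
  have fupos := fp _ upos
  have fapos := fp _ ha
  have fau : f a ≤ f (u r) := fm ha.le upos.le ua
  have hn2 : (0:ℝ) < (n:ℝ) - 2 := by
    have : (3:ℝ) ≤ n := by exact_mod_cast hn
    linarith
  have hI0 : 0 ≤ ∫ s in Ioi (0:ℝ), s * q s := by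
    apply setIntegral_nonneg measurableSet_Ioi
    intro s hs
    exact mul_nonneg (le_of_lt hs) (q0 s (le_of_lt hs))
  have hL0 : 0 ≤ Lcoef n q := by unfold Lcoef; positivity
  -- bound on v
  have vb : v r ≤ b + f (u r) * Lcoef n q := by
    rw [hv r (hsub hrI), lK r hrI]
    have h1 := koK_eq (n-1) (by omega) l lc (fun s _ => l0 s) r hr.1.le
    rw [hncast] at h1
    have h2 : ∫ s in (0:ℝ)..r, s * l s ≤ f (u r) * ∫ s in Ioi (0:ℝ), s * q s := by
      have hqii : IntervalIntegrable (fun s => s * q s) volume 0 r := by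
        apply ContinuousOn.intervalIntegrable_of_Icc hr.1.le
        exact continuousOn_id.mul (qc.mono fun x hx => hx.1)
      have h3 : ∫ s in (0:ℝ)..r, s * l s ≤ ∫ s in (0:ℝ)..r, f (u r) * (s * q s) := by
        apply intervalIntegral.integral_mono_on hr.1.le
        · exact (continuous_id.mul lc).intervalIntegrable _ _
        · exact hqii.const_mul _
        · intro s hs
          have hsR : s ∈ Icc 0 R := ⟨hs.1, hs.2.trans hrR.le⟩
          rw [le s hsR]
          have h4 : f (u s) ≤ f (u r) :=
            fm (hpos s (hsub hsR)).1.le upos.le (umono s hs)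
          have h5 : 0 ≤ s * q s := mul_nonneg hs.1 (q0 s hs.1)
          calc s * (q s * f (u s)) = (s * q s) * f (u s) := by ring
            _ ≤ (s * q s) * f (u r) := by gcongr
            _ = _ := by ring
      refine h3.trans ?_
      rw [intervalIntegral.integral_const_mul, intervalIntegral.integral_of_le hr.1.le]
      apply mul_le_mul_of_nonneg_left _ fupos.le
      apply setIntegral_mono_set qi
      · filter_upwards [ae_restrict_mem measurableSet_Ioi] with s hs
        exact mul_nonneg (le_of_lt hs) (q0 s (le_of_lt hs))
      · exact Ioc_subset_Ioi_self.eventuallyLE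
    have h6 : 1 / ((n:ℝ) - 1 - 1) * ∫ s in (0:ℝ)..r, s * l s
        ≤ 1 / ((n:ℝ) - 2) * (f (u r) * ∫ s in Ioi (0:ℝ), s * q s) := by
      rw [show (n:ℝ) - 1 - 1 = n - 2 by ring]
      gcongr
    have h7 : f (u r) * Lcoef n q
        = 1 / ((n:ℝ) - 2) * (f (u r) * ∫ s in Ioi (0:ℝ), s * q s) := by
      unfold Lcoef; ring
    rw [h7]
    linarith
  have hD0 : 0 ≤ b / f a + Lcoef n q := by positivity
  have vb2 : v r ≤ (b / f a + Lcoef n q) * f (u r) := by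
    have : b ≤ b / f a * f (u r) := by
      rw [div_mul_eq_mul_div, le_div_iff₀ fapos]; gcongr
    linarith
  have gvb : g (v r) ≤ g (b / f a + Lcoef n q) * g (f (u r)) :=
    (gm vpos.le (mul_nonneg hD0 fupos.le) vb2).trans (gs _ hD0 _ fupos.le)
  refine ko_transform (fun s => g (f s)) (fun s hs => gp _ (fp s hs))
    (gd.comp fd fun x hx => fp x hx) ?_ hint1 u G
    (k r - ((n - 1 : ℕ) : ℝ) / r * G r) (((n:ℝ) - 1) / r) _ r ?_ (koA_deriv (n-1) k kc r hr.1) ?_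
  · intro x hx y hy hxy
    exact gm (fp x hx).le (fp y hy).le (fm (mem_Ioi.1 hx).le (mem_Ioi.1 hy).le hxy)
  · filter_upwards [Ioo_mem_nhds hr.1 hrR] with x hx
    have hxI : x ∈ Icc 0 R := ⟨hx.1.le, hx.2.le⟩
    refine ⟨?_, (hpos x (hsub hxI)).1⟩
    refine ((dK x).const_add a).congr_of_eventuallyEq ?_
    filter_upwards [Ioo_mem_nhds hx.1 hx.2] with y hy
    have hyI : y ∈ Icc 0 R := ⟨hy.1.le, hy.2.le⟩
    rw [hu y (hsub hyI), kK y hyI]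
  · rw [ke r hrI, hncast]
    have := mul_le_mul_of_nonneg_left gvb (p0 r hr.1.le)
    linarith

/-- Lemma: Forcing inequality, second part, via the
Keller–Osserman transforms. -/
theorem forcing_inequality_transformed
    (n : ℕ) (hn : 3 ≤ n) (f g p q : ℝ → ℝ)
    (hF1 : hypF1 f g) (hF2 : hypF2 f g) (hPQ : hypPQ p q)
    (hint1 : IntegrableOn (fun s : ℝ => 1 / g (f s)) (Ioi 1))
    (hint2 : IntegrableOn (fun s : ℝ => 1 / f (g s)) (Ioi 1))
    (a b ρ : ℝ) (ha : 0 < a) (hb : 0 < b)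
    (u v : ℝ → ℝ) (hsol : IsRadSol n p q f g a b ρ u v) :
    ∀ r ∈ Ioo (0:ℝ) ρ,
      -(p r * g (b / f a + Lcoef n q)) ≤
        deriv (deriv (fun x => PhiKO f g (u x))) r +
          ((n : ℝ) - 1) / r * deriv (fun x => PhiKO f g (u x)) r ∧
      -(q r * f (a / g b + Lcoef n p)) ≤
        deriv (deriv (fun x => PsiKO f g (v x))) r +
          ((n : ℝ) - 1) / r * deriv (fun x => PsiKO f g (v x)) r := by
  obtain ⟨fc, gc, fd, gd, fm, gm, -, -, fp, gp⟩ := hF1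
  obtain ⟨fs, gs⟩ := hF2
  obtain ⟨pc, qc, p0, q0, -, pi, qi, -⟩ := hPQ
  obtain ⟨uc, vc, hpos, hu, hv⟩ := hsol
  intro r hr
  exact ⟨ko_half n hn f g p q fc gc fd gd fm gm fp gp gs pc qc p0 q0 qi hint1 a b ρ ha hb u v
      uc.continuousOn vc.continuousOn hpos hu hv r hr,
    ko_half n hn g f q p gc fc gd fd gm fm gp fp fs qc pc q0 p0 pi hint2 b a ρ hb ha v u
      vc.continuousOn uc.continuousOn (fun x hx => (hpos x hx).symm) hv hu r hr⟩
end

section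
/- Let (u,v) be a positive radial C² solution of the system on [0,ρ) with central values (a,b), a,b > 0, and with u and v nondecreasing on [0,ρ). Then for every r ∈ [0,ρ): v(r) ≤ b + L_q · f(u(r)) and u(r) ≤ a + L_p · g(v(r)). -/
open MeasureTheory Set Filter Topology

lemma radK_le (n : ℕ) (hn : 3 ≤ n) (w h φ : ℝ → ℝ) (r : ℝ) (hr : 0 ≤ r)
    (hw : ContinuousOn w (Ici 0)) (hw0 : ∀ s : ℝ, 0 ≤ s → 0 ≤ w s)
    (hwi : IntegrableOn (fun s : ℝ => s * w s) (Ioi 0))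
    (hc : ContinuousOn h (Ici 0)) (hm : MonotoneOn h (Ici 0)) (h0 : h 0 = 0)
    (hφc : ContinuousOn φ (Icc 0 r)) (hφ0 : ∀ s ∈ Icc 0 r, 0 < φ s)
    (hφm : ∀ s ∈ Icc 0 r, φ s ≤ φ r) :
    radK n w h φ r ≤ Lcoef n w * h (φ r) := by
  obtain ⟨m, rfl⟩ : ∃ m, n = m + 3 := ⟨n - 3, by omega⟩
  have e1 : (1 - ((m + 3 : ℕ) : ℤ)) = -((m + 2 : ℕ) : ℤ) := by push_cast; ring
  have e2 : (((m + 3 : ℕ) : ℤ) - 1) = ((m + 2 : ℕ) : ℤ) := by push_cast; ring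
  unfold radK Lcoef
  rw [e1, e2]
  simp only [zpow_neg, zpow_natCast]
  have hr' : r ∈ Icc 0 r := ⟨hr, le_rfl⟩
  set H := h (φ r) with hH
  have hH0 : 0 ≤ H := by
    rw [← h0]; exact hm self_mem_Ici (hφ0 r hr').le (hφ0 r hr').le
  have hmr : (((m + 3 : ℕ) : ℝ) - 2) = (m : ℝ) + 1 := by push_cast; ring
  rw [hmr]
  have hm1 : (0:ℝ) < (m : ℝ) + 1 := by positivity
  set wt : ℝ → ℝ := fun s => w (max s 0) with hwt
  have hwtc : Continuous wt := by
    have := hw.comp_continuous (f := fun s : ℝ => max s 0) (by fun_prop) (fun s => mem_Ici.2 (le_max_right s 0))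
    exact this
  have hwt0 : ∀ s, 0 ≤ wt s := fun s => hw0 _ (le_max_right _ _)
  have hwte : ∀ s, 0 ≤ s → wt s = w s := fun s hs => by simp [hwt, max_eq_left hs]
  have cW : Continuous (fun s : ℝ => s ^ (m + 2) * wt s) := by fun_prop
  have cJ : Continuous (fun s : ℝ => s * wt s) := by fun_prop
  set W : ℝ → ℝ := fun t => ∫ s in (0:ℝ)..t, s ^ (m + 2) * wt s with hW
  set J : ℝ → ℝ := fun t => ∫ s in (0:ℝ)..t, s * wt s with hJ
  have dW : ∀ t, HasDerivAt W (t ^ (m + 2) * wt t) t := fun t =>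
    intervalIntegral.integral_hasDerivAt_right (cW.intervalIntegrable _ _)
      (cW.stronglyMeasurableAtFilter _ _) cW.continuousAt
  have dJ : ∀ t, HasDerivAt J (t * wt t) t := fun t =>
    intervalIntegral.integral_hasDerivAt_right (cJ.intervalIntegrable _ _)
      (cJ.stronglyMeasurableAtFilter _ _) cJ.continuousAt
  have W0 : ∀ t, 0 ≤ t → 0 ≤ W t := fun t ht =>
    intervalIntegral.integral_nonneg ht (fun s hs => mul_nonneg (pow_nonneg hs.1 _) (hwt0 s))
  have J0 : ∀ t, 0 ≤ t → 0 ≤ J t := fun t ht =>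
    intervalIntegral.integral_nonneg ht (fun s hs => mul_nonneg hs.1 (hwt0 s))
  have WJ : ∀ t, 0 ≤ t → W t ≤ t ^ (m + 1) * J t := by
    intro t ht
    simp only [hW, hJ]
    rw [← intervalIntegral.integral_const_mul]
    refine intervalIntegral.integral_mono_on ht (cW.intervalIntegrable _ _)
      ((continuous_const.mul cJ).intervalIntegrable _ _) ?_
    intro s hs
    have h1 : s ^ (m + 1) ≤ t ^ (m + 1) := pow_le_pow_left₀ hs.1 hs.2 _
    have h2 := mul_nonneg hs.1 (hwt0 s)
    calc s ^ (m + 2) * wt s = s ^ (m + 1) * (s * wt s) := by ring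
      _ ≤ _ := mul_le_mul_of_nonneg_right h1 h2
  have JL : J r ≤ ∫ s in Ioi (0:ℝ), s * w s := by
    simp only [hJ]
    rw [intervalIntegral.integral_of_le hr]
    rw [setIntegral_congr_fun (g := fun s => s * w s) measurableSet_Ioc
      (fun s hs => by simp only [hwte s hs.1.le])]
    refine setIntegral_mono_set hwi ?_ (Ioc_subset_Ioi_self.eventuallyLE)
    filter_upwards [ae_restrict_mem measurableSet_Ioi] with s hs
    exact mul_nonneg (le_of_lt hs) (hw0 s (le_of_lt hs))
  set F : ℝ → ℝ := fun t => H * (1 / ((m:ℝ) + 1) * (J t - (t ^ (m + 1))⁻¹ * W t)) with hF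
  have key : ∀ t, 0 ≤ t → (t ^ (m + 1))⁻¹ * W t ≤ J t := by
    intro t ht
    rcases ht.eq_or_lt with rfl | ht'
    · simp [hJ]
    · rw [inv_mul_le_iff₀ (by positivity)]; exact WJ t ht
  have dF : ∀ t, 0 < t → HasDerivAt F (H * ((t ^ (m + 2))⁻¹ * W t)) t := by
    intro t ht
    have hp : HasDerivAt (fun t : ℝ => (t ^ (m + 1))⁻¹)
        (-(((m + 1 : ℕ) : ℝ) * t ^ m) / (t ^ (m + 1)) ^ 2) t := by
      exact (hasDerivAt_pow (m + 1) t).inv (by positivity)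
    have := (((dJ t).sub (hp.mul (dW t))).const_mul (1 / ((m:ℝ) + 1))).const_mul H
    refine this.congr_deriv ?_
    push_cast
    field_simp
    ring
  have F0 : F 0 = 0 := by simp [hF, hJ]
  have cJ' : Continuous J := continuous_iff_continuousAt.2 fun t => (dJ t).continuousAt
  have cF : ContinuousOn F (Icc 0 r) := by
    intro t ht
    rcases ht.1.eq_or_lt with rfl | ht'
    · have tJ : Tendsto J (𝓝[Icc 0 r] 0) (𝓝 0) := by
        have := (cJ'.tendsto 0).mono_left (nhdsWithin_le_nhds (s := Icc 0 r))
        simpa [hJ] using this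
      have tS : Tendsto (fun t => (t ^ (m + 1))⁻¹ * W t) (𝓝[Icc 0 r] 0) (𝓝 0) := by
        refine tendsto_of_tendsto_of_tendsto_of_le_of_le' tendsto_const_nhds tJ ?_ ?_
        · filter_upwards [self_mem_nhdsWithin] with s hs
          exact mul_nonneg (inv_nonneg.2 (pow_nonneg hs.1 _)) (W0 s hs.1)
        · filter_upwards [self_mem_nhdsWithin] with s hs
          exact key s hs.1
      have := ((tJ.sub tS).const_mul (1 / ((m:ℝ) + 1))).const_mul H
      unfold ContinuousWithinAt
      rw [F0]
      simpa [hF] using this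
    · exact (dF t ht').continuousAt.continuousWithinAt
  have FL : F r ≤ 1 / ((m:ℝ) + 1) * (∫ s in Ioi (0:ℝ), s * w s) * H := by
    have : J r - (r ^ (m + 1))⁻¹ * W r ≤ ∫ s in Ioi (0:ℝ), s * w s := by
      have := mul_nonneg (inv_nonneg.2 (pow_nonneg hr (m + 1))) (W0 r hr)
      linarith
    simp only [hF]
    rw [mul_comm]
    gcongr
  by_cases hi : IntervalIntegrable (fun t : ℝ => (t ^ (m + 2))⁻¹ *
      ∫ s in (0:ℝ)..t, s ^ (m + 2) * w s * h (φ s)) volume 0 r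
  · refine le_trans ?_ FL
    have := intervalIntegral.integral_le_sub_of_hasDeriv_right_of_le hr cF
      (fun t ht => (dF t ht.1).hasDerivWithinAt)
      ((intervalIntegrable_iff_integrableOn_Icc_of_le hr).1 hi) ?_
    · simpa [F0] using this
    · intro t ht
      have hG : (∫ s in (0:ℝ)..t, s ^ (m + 2) * w s * h (φ s)) ≤ H * W t := by
        simp only [hW]
        rw [← intervalIntegral.integral_const_mul]
        have hsub : Icc 0 t ⊆ Icc 0 r := Icc_subset_Icc_right ht.2.le
        refine intervalIntegral.integral_mono_on ht.1.le ?_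
          ((continuous_const.mul cW).intervalIntegrable _ _) ?_
        · apply ContinuousOn.intervalIntegrable
          rw [uIcc_of_le ht.1.le]
          refine ((continuousOn_id.pow _).mul (hw.mono fun s hs => hs.1)).mul ?_
          exact hc.comp (hφc.mono hsub) fun s hs => (hφ0 s (hsub hs)).le
        · intro s hs
          rw [hwte s hs.1, mul_comm]
          exact mul_le_mul_of_nonneg_right
            (hm (hφ0 s (hsub hs)).le (hφ0 r hr').le (hφm s (hsub hs)))
            (mul_nonneg (pow_nonneg hs.1 _) (hw0 s hs.1))
      have := mul_le_mul_of_nonneg_left hG (inv_nonneg.2 (pow_nonneg ht.1.le (m + 2)))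
      linarith
  · rw [intervalIntegral.integral_undef hi]
    refine mul_nonneg (mul_nonneg (by positivity) ((J0 r hr).trans JL)) hH0

/-- basic pointwise bounds for monotone solutions. -/
theorem pointwise_bounds
    (n : ℕ) (hn : 3 ≤ n) (f g p q : ℝ → ℝ)
    (hF1 : hypF1 f g) (hPQ : hypPQ p q)
    (a b ρ : ℝ) (ha : 0 < a) (hb : 0 < b)
    (u v : ℝ → ℝ) (hsol : IsRadSol n p q f g a b ρ u v)
    (hu : MonotoneOn u (Ico 0 ρ)) (hv : MonotoneOn v (Ico 0 ρ)) :
    ∀ r ∈ Ico (0:ℝ) ρ,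
      v r ≤ b + Lcoef n q * f (u r) ∧ u r ≤ a + Lcoef n p * g (v r) := by
  obtain ⟨hf, hg, -, -, hfm, hgm, hf0, hg0, -, -⟩ := hF1
  obtain ⟨hp, hq, hp0, hq0, -, hpi, hqi, -⟩ := hPQ
  obtain ⟨huc, hvc, hpos, hue, hve⟩ := hsol
  intro r hr
  have hsub : Icc 0 r ⊆ Ico 0 ρ := fun s hs => ⟨hs.1, hs.2.trans_lt hr.2⟩
  constructor
  · rw [hve r hr]
    have := radK_le n hn q f u r hr.1 hq hq0 hqi hf hfm hf0 (huc.continuousOn.mono hsub)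
      (fun s hs => (hpos s (hsub hs)).1) (fun s hs => hu (hsub hs) hr hs.2)
    linarith
  · rw [hue r hr]
    have := radK_le n hn p g v r hr.1 hp hp0 hpi hg hgm hg0 (hvc.continuousOn.mono hsub)
      (fun s hs => (hpos s (hsub hs)).2) (fun s hs => hv (hsub hs) hr hs.2)
    linarith
end

section
/- Let f, g : [0,∞) → [0,∞) be nondecreasing continuous functions with f(0)=g(0)=0 and f(s)>0, g(s)>0 for all s>0. If ∫₁^∞ dt/f(t) < ∞ and ∫₁^∞ dt/g(t) < ∞, then ∫₁^∞ dt/g(f(t)) < ∞ and ∫₁^∞ dt/f(g(t)) < ∞. -/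
open MeasureTheory Set Filter Topology

theorem aux_lin (g : ℝ → ℝ) (hgm : MonotoneOn g (Ici 0))
    (hgp : ∀ s : ℝ, 0 < s → 0 < g s)
    (hintg : IntegrableOn (fun t : ℝ => 1 / g t) (Ioi 1)) (a : ℝ) (ha : 0 < a) :
    ∃ K : ℝ, ∀ s : ℝ, a ≤ s → s ≤ K * g s := by
  have hI : 0 ≤ ∫ t in Ioi (1:ℝ), 1 / g t := by
    refine setIntegral_nonneg measurableSet_Ioi fun t ht => ?_
    have := hgp t (lt_trans one_pos ht)
    positivity
  refine ⟨2 * (∫ t in Ioi (1:ℝ), 1 / g t) + 2 / g a, fun s hs => ?_⟩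
  have hs0 : 0 < s := ha.trans_le hs
  have hgs := hgp s hs0
  have hga := hgp a ha
  have hle : g a ≤ g s := hgm ha.le hs0.le hs
  rcases le_total s 2 with h2 | h2
  · have h3 : 2 ≤ 2 / g a * g s := by
      rw [div_mul_eq_mul_div, le_div_iff₀ hga]; linarith
    nlinarith [mul_nonneg hI hgs.le]
  · have h4 : (s - 1) * (1 / g s) ≤ ∫ t in Ioi (1:ℝ), 1 / g t := by
      have h5 : ∫ t in Ioc (1:ℝ) s, 1 / g s ≤ ∫ t in Ioc (1:ℝ) s, 1 / g t := by
        refine setIntegral_mono_on (by simp) (hintg.mono_set Ioc_subset_Ioi_self)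
          measurableSet_Ioc fun t ht => ?_
        have ht0 : 0 < t := lt_trans one_pos ht.1
        exact one_div_le_one_div_of_le (hgp t ht0) (hgm ht0.le hs0.le ht.2)
      have h6 : ∫ t in Ioc (1:ℝ) s, 1 / g t ≤ ∫ t in Ioi (1:ℝ), 1 / g t := by
        refine setIntegral_mono_set hintg ?_ Ioc_subset_Ioi_self.eventuallyLE
        refine (ae_restrict_iff' measurableSet_Ioi).2 (ae_of_all _ fun t ht => ?_)
        have := hgp t (lt_trans one_pos ht)
        simp only [Pi.zero_apply]
        positivity
      have h7 : ∫ t in Ioc (1:ℝ) s, 1 / g s = (s - 1) * (1 / g s) := by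
        rw [setIntegral_const, smul_eq_mul, measureReal_def, Real.volume_Ioc,
          ENNReal.toReal_ofReal (by linarith)]
      linarith
    rw [mul_one_div, div_le_iff₀ hgs] at h4
    have : 0 ≤ 2 / g a * g s := by positivity
    nlinarith

theorem aux_comp (f g : ℝ → ℝ)
    (hfc : ContinuousOn f (Ici 0)) (hgc : ContinuousOn g (Ici 0))
    (hfm : MonotoneOn f (Ici 0)) (hgm : MonotoneOn g (Ici 0))
    (hfp : ∀ s : ℝ, 0 < s → 0 < f s) (hgp : ∀ s : ℝ, 0 < s → 0 < g s)
    (hintf : IntegrableOn (fun t : ℝ => 1 / f t) (Ioi 1))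
    (hintg : IntegrableOn (fun t : ℝ => 1 / g t) (Ioi 1)) :
    IntegrableOn (fun t : ℝ => 1 / g (f t)) (Ioi 1) := by
  obtain ⟨K, hK⟩ := aux_lin g hgm hgp hintg (f 1) (hfp 1 one_pos)
  have hpos : ∀ t ∈ Ioi (1:ℝ), 0 < t := fun t ht => lt_trans one_pos ht
  refine Integrable.mono' (hintf.const_mul K) ?_ ?_
  · refine ContinuousOn.aestronglyMeasurable ?_ measurableSet_Ioi
    refine continuousOn_const.div ?_ fun t ht => (hgp _ (hfp t (hpos t ht))).ne'
    exact hgc.comp (hfc.mono fun t ht => (hpos t ht).le) fun t ht => (hfp t (hpos t ht)).le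
  · refine (ae_restrict_iff' measurableSet_Ioi).2 (ae_of_all _ fun t ht => ?_)
    have hf := hfp t (hpos t ht)
    have hg := hgp _ hf
    have h := hK (f t) (hfm (mem_Ici.2 zero_le_one) (hpos t ht).le (le_of_lt ht))
    rw [Real.norm_of_nonneg (by positivity), mul_one_div, div_le_div_iff₀ hg hf]
    linarith

/-- Appendix theorem: integrability of reciprocals of the
compositions. -/
theorem integrability_of_compositions
    (f g : ℝ → ℝ)
    (hfc : ContinuousOn f (Ici 0)) (hgc : ContinuousOn g (Ici 0))
    (hfm : MonotoneOn f (Ici 0)) (hgm : MonotoneOn g (Ici 0))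
    (hf0 : f 0 = 0) (hg0 : g 0 = 0)
    (hfp : ∀ s : ℝ, 0 < s → 0 < f s) (hgp : ∀ s : ℝ, 0 < s → 0 < g s)
    (hintf : IntegrableOn (fun t : ℝ => 1 / f t) (Ioi 1))
    (hintg : IntegrableOn (fun t : ℝ => 1 / g t) (Ioi 1)) :
    IntegrableOn (fun t : ℝ => 1 / g (f t)) (Ioi 1) ∧
    IntegrableOn (fun t : ℝ => 1 / f (g t)) (Ioi 1) := by
  exact ⟨aux_comp f g hfc hgc hfm hgm hfp hgp hintf hintg,
    aux_comp g f hgc hfc hgm hfm hgp hfp hintg hintf⟩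
end
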